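/- arXiv:math/0307167 — 8 statements merged into one kernel-verified Lean document; each statement's English description precedes it below -/
import Mathlib

section
/- Consider two families of parameterized discrete-time systems on ℝⁿ, an 'approximate' closed loop x̃(k+1)=F̃ᵃ_T(k,x̃(k)) and an 'exact' closed loop x̃(k+1)=F̃ᵉ_T(k,x̃(k)), with solutions φᵃ_T(k,k₀,x̃₀) and φᵉ_T(k,k₀,x̃₀). Suppose there exists β of class KL such that for any strictly positive numbers (L,η,Δ,δ) there exist a function α:[0,∞)×[0,∞)→[0,∞] and T*>0 such that for all k₀≥0, |x̃₀|≤Δ and T∈(0,T*): (i) |φᵃ_T(k,k₀,x̃₀)| ≤ β(|x̃₀|,T(k−k₀))+δ for all k≥k₀; (ii) whenever max{|x̃₁|,|x̃₂|}≤Δ, |x̃₁−x̃₂|≤c and k≥0, then |F̃ᵉ_T(k,x̃₁)−F̃ᵃ_T(k,x̃₂)| ≤ α(c,T); and (iii) the k-fold iterate of the map c↦α(c,T) started at 0 satisfies αᵏ(0,T) ≤ η for all integers k∈[0,ℓ_{L,T}]. Then for any strictly positive numbers (Δ̃,δ̃) there exists T̃>0 such that for all k₀≥0, |x̃₀|≤Δ̃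 and T∈(0,T̃), the exact closed loop satisfies |φᵉ_T(k,k₀,x̃₀)| ≤ β(|x̃₀|,T(k−k₀))+δ̃ for all k≥k₀. -/
open Filter Topology

/-- Class `K` functions: continuous on `[0,∞)`, strictly increasing there, and zero at zero. -/
def ClassK (α : ℝ → ℝ) : Prop :=
  ContinuousOn α (Set.Ici 0) ∧ StrictMonoOn α (Set.Ici 0) ∧ α 0 = 0

/-- Class `K∞` functions: class `K` and unbounded. -/
def ClassKInfty (α : ℝ → ℝ) : Prop :=
  ClassK α ∧ ∀ M : ℝ, ∃ s : ℝ, 0 ≤ s ∧ M < α s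

/-- Class `KL` functions. -/
def ClassKL (β : ℝ → ℝ → ℝ) : Prop :=
  (∀ t : ℝ, 0 < t → ClassK (fun s => β s t)) ∧
  (∀ s : ℝ, 0 < s → AntitoneOn (fun t => β s t) (Set.Ici 0) ∧
    Filter.Tendsto (fun t => β s t) Filter.atTop (nhds 0))

/-- Class `N` functions: continuous, nondecreasing and nonnegative on `[0,∞)`. -/
def ClassN (γ : ℝ → ℝ) : Prop :=
  ContinuousOn γ (Set.Ici 0) ∧ MonotoneOn γ (Set.Ici 0) ∧ ∀ s : ℝ, 0 ≤ s → 0 ≤ γ s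

/-- Euclidean norm of the joint state `(x, z)`. -/
noncomputable def jnorm {E F : Type*} [NormedAddCommGroup E] [NormedAddCommGroup F]
    (x : E) (z : F) : ℝ :=
  Real.sqrt (‖x‖ ^ 2 + ‖z‖ ^ 2)

namespace ClassKL

variable {β : ℝ → ℝ → ℝ}

lemma nonneg (hβ : ClassKL β) {s t : ℝ} (hs : 0 ≤ s) (ht : 0 < t) : 0 ≤ β s t := by
  obtain ⟨-, hmono, hzero⟩ := hβ.1 t ht
  rw [← hzero]
  exact hmono.monotoneOn (Set.mem_Ici.2 le_rfl) (Set.mem_Ici.2 hs) hs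

lemma mono_left (hβ : ClassKL β) {s s' t : ℝ} (hs : 0 ≤ s) (hss' : s ≤ s') (ht : 0 < t) :
    β s t ≤ β s' t :=
  (hβ.1 t ht).2.1.monotoneOn (Set.mem_Ici.2 hs) (Set.mem_Ici.2 (hs.trans hss')) hss'

lemma le_zero_right (hβ : ClassKL β) {s s' t : ℝ} (hs : 0 ≤ s) (hss' : s ≤ s') (hs' : 0 < s')
    (ht : 0 < t) : β s t ≤ β s' 0 :=
  (hβ.mono_left hs hss' ht).trans
    ((hβ.2 s' hs').1 (Set.mem_Ici.2 le_rfl) (Set.mem_Ici.2 ht.le) ht.le)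

end ClassKL

/-- The gap between an exact and an approximate trajectory with the same initial value is bounded
by the iterates of the consistency bound, as long as both stay in the ball of radius `Δ`. -/
lemma nnnorm_sub_le_iterate {E : Type*} [NormedAddCommGroup E] {Fa Fe : ℕ → E → E}
    {a : ENNReal → ENNReal} {Δ : ℝ}
    (hcons : ∀ (c : ENNReal) (k : ℕ) (x₁ x₂ : E), ‖x₁‖ ≤ Δ → ‖x₂‖ ≤ Δ →
      (‖x₁ - x₂‖₊ : ENNReal) ≤ c → (‖Fe k x₁ - Fa k x₂‖₊ : ENNReal) ≤ a c)
    {k₀ : ℕ} {φe φa : ℕ → E} (he : ∀ k, k₀ ≤ k → φe (k + 1) = Fe k (φe k))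
    (ha : ∀ k, k₀ ≤ k → φa (k + 1) = Fa k (φa k)) (h0 : φe k₀ = φa k₀) (j : ℕ)
    (heΔ : ∀ i < j, ‖φe (k₀ + i)‖ ≤ Δ) (haΔ : ∀ i < j, ‖φa (k₀ + i)‖ ≤ Δ) :
    (‖φe (k₀ + j) - φa (k₀ + j)‖₊ : ENNReal) ≤ a^[j] 0 := by
  induction j with
  | zero => simp [h0]
  | succ j ih =>
    rw [Function.iterate_succ_apply', ← add_assoc, he _ (by omega), ha _ (by omega)]
    exact hcons _ _ _ _ (heΔ j (by omega)) (haΔ j (by omega))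
      (ih (fun i hi => heΔ i (by omega)) (fun i hi => haΔ i (by omega)))

/-- Over a window on which the consistency bound stays below `η`, the exact trajectory inherits the
bound of the approximate one, with offset `δ + η`. -/
lemma norm_le_of_consistent {E : Type*} [NormedAddCommGroup E] {Fa Fe : ℕ → E → E}
    {β : ℝ → ℝ → ℝ} (hβ : ClassKL β) {a : ENNReal → ENNReal} {Δ M δ η T : ℝ} {N : ℕ}
    (hT : 0 < T) (hM : 0 < M) (hη : 0 ≤ η) (hMΔ : M ≤ Δ) (hβΔ : β M 0 + δ ≤ Δ)
    (hstab : ∀ k₀ : ℕ, ∀ φa : ℕ → E, (∀ k, k₀ ≤ k → φa (k + 1) = Fa k (φa k)) → ‖φa k₀‖ ≤ Δ →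
      ∀ k, k₀ ≤ k → ‖φa k‖ ≤ β ‖φa k₀‖ (T * ((k - k₀ : ℕ) : ℝ)) + δ)
    (hcons : ∀ (c : ENNReal) (k : ℕ) (x₁ x₂ : E), ‖x₁‖ ≤ Δ → ‖x₂‖ ≤ Δ →
      (‖x₁ - x₂‖₊ : ENNReal) ≤ c → (‖Fe k x₁ - Fa k x₂‖₊ : ENNReal) ≤ a c)
    (hiter : ∀ k ≤ N, a^[k] 0 ≤ ENNReal.ofReal η)
    {k₀ : ℕ} {φe : ℕ → E} (he : ∀ k, k₀ ≤ k → φe (k + 1) = Fe k (φe k)) {j : ℕ} (hj : j ≤ N)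
    (h0 : ‖φe k₀‖ ≤ M) (hbd : ∀ i < j, ‖φe (k₀ + i)‖ ≤ M) :
    ‖φe (k₀ + j)‖ ≤ β ‖φe k₀‖ (T * j) + δ + η := by
  let ψ : ℕ → E := fun m => Nat.rec (φe k₀) (fun i x => Fa (k₀ + i) x) m
  let φa : ℕ → E := fun m => ψ (m - k₀)
  have hφ0 : φa k₀ = φe k₀ := by simp [φa, ψ]
  have ha : ∀ k, k₀ ≤ k → φa (k + 1) = Fa k (φa k) := by
    intro k hk
    obtain ⟨i, rfl⟩ := Nat.exists_eq_add_of_le hk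
    simp only [φa, add_assoc, Nat.add_sub_cancel_left, ψ]
  have hbound : ∀ i : ℕ, ‖φa (k₀ + i)‖ ≤ β ‖φe k₀‖ (T * i) + δ := by
    intro i
    have := hstab k₀ φa ha (by rw [hφ0]; exact h0.trans hMΔ) (k₀ + i) (by omega)
    rwa [hφ0, Nat.add_sub_cancel_left] at this
  have haΔ : ∀ i < j, ‖φa (k₀ + i)‖ ≤ Δ := by
    intro i _
    rcases Nat.eq_zero_or_pos i with rfl | hi
    · rw [add_zero, hφ0]
      exact h0.trans hMΔ
    · have hti : 0 < T * (i : ℝ) := mul_pos hT (by exact_mod_cast hi)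
      linarith [hbound i, hβ.le_zero_right (norm_nonneg _) h0 hM hti]
  have hgap := (nnnorm_sub_le_iterate hcons he ha hφ0.symm j
    (fun i hi => (hbd i hi).trans hMΔ) haΔ).trans (hiter j hj)
  have hgap' : ‖φe (k₀ + j) - φa (k₀ + j)‖ ≤ η := by
    rw [← enorm_eq_nnnorm, ← ofReal_norm, ENNReal.ofReal_le_ofReal_iff hη] at hgap
    exact hgap
  linarith [hbound j, norm_sub_norm_le (φe (k₀ + j)) (φa (k₀ + j))]

/-- if the approximate closed loop is SP-UAS (with `KL` bound `β` and offset `δ`)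
and the exact and approximate maps are multiple-step consistent, then the exact closed loop is
SP-UAS with the same `β` and an arbitrarily small offset `δ̃`. -/
theorem stmt0 (n : ℕ)
    (Fa Fe : ℝ → ℕ → EuclideanSpace ℝ (Fin n) → EuclideanSpace ℝ (Fin n))
    (β : ℝ → ℝ → ℝ) (hβ : ClassKL β)
    (H : ∀ L η Δ δ : ℝ, 0 < L → 0 < η → 0 < Δ → 0 < δ →
      ∃ (α : ENNReal → ℝ → ENNReal) (Tstar : ℝ), 0 < Tstar ∧
        ∀ T : ℝ, 0 < T → T < Tstar →
          -- SP-UAS of the approximate closed loop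
          (∀ k₀ : ℕ, ∀ φa : ℕ → EuclideanSpace ℝ (Fin n),
            (∀ k, k₀ ≤ k → φa (k + 1) = Fa T k (φa k)) → ‖φa k₀‖ ≤ Δ →
            ∀ k, k₀ ≤ k → ‖φa k‖ ≤ β ‖φa k₀‖ (T * ((k - k₀ : ℕ) : ℝ)) + δ) ∧
          -- multiple-step consistency between the exact and approximate maps
          (∀ (c : ENNReal) (k : ℕ) (x₁ x₂ : EuclideanSpace ℝ (Fin n)),
            ‖x₁‖ ≤ Δ → ‖x₂‖ ≤ Δ → (‖x₁ - x₂‖₊ : ENNReal) ≤ c →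
            (‖Fe T k x₁ - Fa T k x₂‖₊ : ENNReal) ≤ α c T) ∧
          -- the iterates of `c ↦ α(c,T)` started at `0` stay below `η` up to time `⌊L/T⌋`
          (∀ k : ℕ, k ≤ Nat.floor (L / T) →
            (fun c => α c T)^[k] 0 ≤ ENNReal.ofReal η)) :
    ∀ Δt δt : ℝ, 0 < Δt → 0 < δt → ∃ Tt : ℝ, 0 < Tt ∧
      ∀ T : ℝ, 0 < T → T < Tt →
        ∀ k₀ : ℕ, ∀ φe : ℕ → EuclideanSpace ℝ (Fin n),
          (∀ k, k₀ ≤ k → φe (k + 1) = Fe T k (φe k)) → ‖φe k₀‖ ≤ Δt →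
          ∀ k, k₀ ≤ k → ‖φe k‖ ≤ β ‖φe k₀‖ (T * ((k - k₀ : ℕ) : ℝ)) + δt := by
  intro Δt δt hΔt hδt
  set M : ℝ := Δt + |β Δt 0| + δt with hM_def
  have hM : 0 < M := by positivity
  obtain ⟨L₀, hL₀⟩ := Filter.eventually_atTop.1
    ((hβ.2 M hM).2.eventually (eventually_le_nhds (show (0 : ℝ) < δt / 3 by positivity)))
  set L : ℝ := max L₀ 1 + 1 with hL_def
  have hL : 2 ≤ L := by linarith [le_max_right L₀ 1]
  obtain ⟨α, Ts, hTs, hα⟩ := H L (δt / 3) (M + |β M 0| + δt) (δt / 3) (by linarith)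
    (by positivity) (by positivity) (by positivity)
  refine ⟨min Ts 1, lt_min hTs one_pos, fun T hT hTlt k₀ φe he h0 => ?_⟩
  obtain ⟨hstab, hcons, hiter⟩ := hα T hT (hTlt.trans_le (min_le_left _ _))
  have hT1 : T < 1 := hTlt.trans_le (min_le_right _ _)
  set N : ℕ := ⌊L / T⌋₊ with hN_def
  have hTN : max L₀ 1 ≤ T * N := by
    have h1 : L < (N + 1) * T := (div_lt_iff₀ hT).1 (Nat.lt_floor_add_one (L / T))
    linarith
  have hTNpos : 0 < T * (N : ℝ) := by linarith [le_max_right L₀ 1]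
  have hN : 0 < N := Nat.pos_of_ne_zero fun h => by simp [h] at hTNpos
  have hwindow : ∀ k₁ j : ℕ, k₀ ≤ k₁ → j ≤ N → ‖φe k₁‖ ≤ M → (∀ i < j, ‖φe (k₁ + i)‖ ≤ M) →
      ‖φe (k₁ + j)‖ ≤ β ‖φe k₁‖ (T * j) + δt / 3 + δt / 3 := fun k₁ j hk₁ hj h1 hbd =>
    norm_le_of_consistent hβ hT hM (by positivity)
      (by linarith [abs_nonneg (β M 0)]) (by linarith [le_abs_self (β M 0)]) hstab hcons hiter
      (fun k hk => he k (hk₁.trans hk)) hj h1 hbd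
  have h0M : ‖φe k₀‖ ≤ M := by linarith [abs_nonneg (β Δt 0)]
  have key : ∀ d : ℕ, ‖φe (k₀ + d)‖ ≤ β ‖φe k₀‖ (T * d) + δt ∧ ‖φe (k₀ + d)‖ ≤ M := by
    intro d
    induction d using Nat.strong_induction_on with
    | _ d ih =>
      rcases le_total d N with hd | hd
      · have hw := hwindow k₀ d le_rfl hd h0M fun i hi => (ih i hi).2
        refine ⟨by linarith, ?_⟩
        rcases Nat.eq_zero_or_pos d with rfl | hd0
        · exact h0M
        · have htd : 0 < T * (d : ℝ) := mul_pos hT (by exact_mod_cast hd0)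
          linarith [hβ.le_zero_right (norm_nonneg _) h0 hΔt htd, le_abs_self (β Δt 0)]
      · obtain ⟨e, rfl⟩ := Nat.exists_eq_add_of_le' hd
        have he0 := (ih e (by omega)).2
        have hw := hwindow (k₀ + e) N (by omega) le_rfl he0 fun i hi => by
          rw [add_assoc]
          exact (ih (e + i) (by omega)).2
        rw [add_assoc] at hw
        have htd : 0 < T * ((e + N : ℕ) : ℝ) := mul_pos hT (by exact_mod_cast (by omega))
        have hsmall : ‖φe (k₀ + (e + N))‖ ≤ δt := by
          linarith [hβ.mono_left (norm_nonneg _) he0 hTNpos,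
            hL₀ (T * N) ((le_max_left L₀ 1).trans hTN)]
        exact ⟨by linarith [hβ.nonneg (norm_nonneg (φe k₀)) htd],
          by linarith [abs_nonneg (β Δt 0)]⟩
  intro k hk
  obtain ⟨d, rfl⟩ := Nat.exists_eq_add_of_le hk
  rw [Nat.add_sub_cancel_left]
  exact (key d).1
end

section
/- Consider the (non-parameterized) discrete-time cascade x(k+1)=f(k,x(k),y(k)), y(k+1)=g(k,y(k)), and suppose f is continuous in (x,y) uniformly in k≥0. Then the cascade is UGAS if and only if: (1) the system x(k+1)=f(k,x(k),0) is UGAS; (2) the system y(k+1)=g(k,y(k)) is UGAS; and (3) the cascade is UGB. -/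
open Filter Topology

/-- UGAS of a (non-parameterized) discrete-time system `w(k+1) = F(k, w(k))`. -/
def UGAS {G : Type*} [NormedAddCommGroup G] (F : ℕ → G → G) : Prop :=
  ∃ β : ℝ → ℝ → ℝ, ClassKL β ∧
    ∀ k₀ : ℕ, ∀ w : ℕ → G, (∀ k, k₀ ≤ k → w (k + 1) = F k (w k)) →
      ∀ k, k₀ ≤ k → ‖w k‖ ≤ β ‖w k₀‖ ((k - k₀ : ℕ) : ℝ)

/-- UGAS of the cascade `x(k+1)=f(k,x,y)`, `y(k+1)=g(k,y)` with the Euclidean norm of the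
joint state. -/
def CascadeUGAS {E F : Type*} [NormedAddCommGroup E] [NormedAddCommGroup F]
    (f : ℕ → E → F → E) (g : ℕ → F → F) : Prop :=
  ∃ β : ℝ → ℝ → ℝ, ClassKL β ∧
    ∀ k₀ : ℕ, ∀ x : ℕ → E, ∀ y : ℕ → F,
      (∀ k, k₀ ≤ k → x (k + 1) = f k (x k) (y k)) →
      (∀ k, k₀ ≤ k → y (k + 1) = g k (y k)) →
      ∀ k, k₀ ≤ k → jnorm (x k) (y k) ≤ β (jnorm (x k₀) (y k₀)) ((k - k₀ : ℕ) : ℝ)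

/-- UGB of the cascade `x(k+1)=f(k,x,y)`, `y(k+1)=g(k,y)`. -/
def CascadeUGB {E F : Type*} [NormedAddCommGroup E] [NormedAddCommGroup F]
    (f : ℕ → E → F → E) (g : ℕ → F → F) : Prop :=
  ∃ κ : ℝ → ℝ, ∃ c : ℝ, ClassKInfty κ ∧ 0 ≤ c ∧
    ∀ k₀ : ℕ, ∀ x : ℕ → E, ∀ y : ℕ → F,
      (∀ k, k₀ ≤ k → x (k + 1) = f k (x k) (y k)) →
      (∀ k, k₀ ≤ k → y (k + 1) = g k (y k)) →
      ∀ k, k₀ ≤ k → jnorm (x k) (y k) ≤ κ (jnorm (x k₀) (y k₀)) + c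

section Norms

variable {E F : Type*} [NormedAddCommGroup E] [NormedAddCommGroup F]

lemma norm_le_jnorm_left (x : E) (y : F) : ‖x‖ ≤ jnorm x y :=
  Real.le_sqrt_of_sq_le (by nlinarith [sq_nonneg ‖y‖])

lemma norm_le_jnorm_right (x : E) (y : F) : ‖y‖ ≤ jnorm x y :=
  Real.le_sqrt_of_sq_le (by nlinarith [sq_nonneg ‖x‖])

lemma jnorm_nonneg (x : E) (y : F) : 0 ≤ jnorm x y := Real.sqrt_nonneg _

lemma jnorm_le_add (x : E) (y : F) : jnorm x y ≤ ‖x‖ + ‖y‖ := by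
  unfold jnorm
  rw [Real.sqrt_le_left (by positivity)]
  nlinarith [mul_nonneg (norm_nonneg x) (norm_nonneg y)]

lemma jnorm_zero_right (x : E) : jnorm x (0 : F) = ‖x‖ := by
  simp [jnorm]

lemma jnorm_zero_left (y : F) : jnorm (0 : E) y = ‖y‖ := by
  simp [jnorm]

end Norms

section KL

lemma ClassK.monotoneOn {α : ℝ → ℝ} (h : ClassK α) : MonotoneOn α (Set.Ici 0) :=
  h.2.1.monotoneOn

lemma ClassK.nonneg {α : ℝ → ℝ} (h : ClassK α) {s : ℝ} (hs : 0 ≤ s) : 0 ≤ α s := by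
  have := h.monotoneOn (Set.mem_Ici.2 le_rfl) (Set.mem_Ici.2 hs) hs
  rwa [h.2.2] at this

lemma ClassK.exists_le {α : ℝ → ℝ} (h : ClassK α) {ε : ℝ} (hε : 0 < ε) :
    ∃ δ : ℝ, 0 < δ ∧ α δ ≤ ε := by
  have hc : ContinuousWithinAt α (Set.Ici 0) 0 := h.1 0 (Set.mem_Ici.2 le_rfl)
  obtain ⟨δ, hδ, H⟩ := Metric.continuousWithinAt_iff.1 hc ε hε
  refine ⟨δ / 2, half_pos hδ, ?_⟩
  have := H (x := δ / 2) (Set.mem_Ici.2 (by linarith))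
    (by rw [Real.dist_eq, sub_zero, abs_of_pos (by linarith)]; linarith)
  rw [h.2.2, Real.dist_eq, sub_zero] at this
  exact (le_abs_self _).trans this.le

namespace ClassKL

variable {β : ℝ → ℝ → ℝ}

lemma le_of_le (h : ClassKL β) {s t t' : ℝ} (hs : 0 ≤ s) (ht : 0 < t) (htt : t ≤ t') :
    β s t' ≤ β s t := by
  rcases hs.eq_or_lt with rfl | hs
  · exact ((h.1 t' (ht.trans_le htt)).2.2.trans (h.1 t ht).2.2.symm).le
  · exact (h.2 s hs).1 (Set.mem_Ici.2 ht.le) (Set.mem_Ici.2 (ht.le.trans htt)) htt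

lemma le_of_le_of_le (h : ClassKL β) {s r t t' : ℝ} (hs : 0 ≤ s) (hsr : s ≤ r) (ht : 0 < t)
    (htt : t ≤ t') : β s t' ≤ β r t :=
  (h.le_of_le hs ht htt).trans
    ((h.1 t ht).monotoneOn (Set.mem_Ici.2 hs) (Set.mem_Ici.2 (hs.trans hsr)) hsr)

lemma exists_nat_le (h : ClassKL β) {r ε : ℝ} (hr : 0 < r) (hε : 0 < ε) :
    ∃ T : ℕ, 0 < T ∧ β r T ≤ ε := by
  have h1 : Tendsto (fun n : ℕ => β r n) atTop (𝓝 0) :=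
    (h.2 r hr).2.comp tendsto_natCast_atTop_atTop
  obtain ⟨T, hT, hT0⟩ := ((h1.eventually (ge_mem_nhds hε)).and (eventually_gt_atTop 0)).exists
  exact ⟨T, hT0, hT⟩

end ClassKL

/-- A function that is monotone in its first argument, antitone and vanishing at infinity in the
second, and right-continuous at the origin, is dominated by a class `KL` function. -/
lemma exists_classKL_ge {φ : ℝ → ℝ → ℝ} (hmono : ∀ t, Monotone fun r => φ r t)
    (hanti : ∀ r, Antitone (φ r)) (hzero : ∀ t, φ 0 t = 0)
    (hsmall : ∀ ε : ℝ, 0 < ε → ∃ δ : ℝ, 0 < δ ∧ ∀ t, φ δ t ≤ ε)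
    (hlim : ∀ r, Tendsto (φ r) atTop (𝓝 0)) :
    ∃ β : ℝ → ℝ → ℝ, ClassKL β ∧ ∀ r t, 0 ≤ r → 0 ≤ t → φ r t ≤ β r t := by
  have hint : ∀ r t a b, 0 ≤ r →
      IntervalIntegrable (fun u => φ (r * u) t) MeasureTheory.volume a b := fun r t a b hr =>
    Monotone.intervalIntegrable fun u v huv => hmono t (mul_le_mul_of_nonneg_left huv hr)
  have hint' : ∀ t a b, IntervalIntegrable (fun u => φ u t) MeasureTheory.volume a b :=
    fun t a b => (hmono t).intervalIntegrable
  set ψ : ℝ → ℝ → ℝ := fun r t => ∫ u in (1 : ℝ)..2, φ (r * u) t with hψ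
  have hconst : ∀ c : ℝ, ∫ _ in (1 : ℝ)..2, c = c := fun c => by
    rw [intervalIntegral.integral_const]; norm_num
  have hlow : ∀ r t, 0 ≤ r → φ r t ≤ ψ r t := fun r t hr => by
    rw [← hconst (φ r t)]
    refine intervalIntegral.integral_mono_on (by norm_num) (by simp) (hint r t _ _ hr)
      fun u hu => hmono t ?_
    nlinarith [hu.1]
  have hupp : ∀ r t, 0 ≤ r → ψ r t ≤ φ (2 * r) t := fun r t hr => by
    rw [← hconst (φ (2 * r) t)]
    refine intervalIntegral.integral_mono_on (by norm_num) (hint r t _ _ hr) (by simp)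
      fun u hu => hmono t ?_
    nlinarith [hu.2]
  have hφ0 : ∀ r t, 0 ≤ r → 0 ≤ φ r t := fun r t hr => hzero t ▸ hmono t hr
  have hψmono : ∀ t, MonotoneOn (fun r => ψ r t) (Set.Ici 0) := fun t r hr r' hr' h =>
    intervalIntegral.integral_mono_on (by norm_num) (hint r t _ _ hr) (hint r' t _ _ hr')
      fun u hu => hmono t (mul_le_mul_of_nonneg_right h (by linarith [hu.1]))
  have hψ0 : ∀ t, ψ 0 t = 0 := fun t => by simp [hψ, hzero]
  have hψcont : ∀ t, ContinuousOn (fun r => ψ r t) (Set.Ici 0) := by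
    intro t r hr
    rcases (Set.mem_Ici.1 hr).eq_or_lt with rfl | hr
    · rw [Metric.continuousWithinAt_iff]
      intro ε hε
      obtain ⟨δ, hδ, H⟩ := hsmall (ε / 2) (half_pos hε)
      refine ⟨δ / 2, half_pos hδ, fun {s} hs hsd => ?_⟩
      have hs0 : 0 ≤ s := hs
      rw [Real.dist_eq, sub_zero, abs_of_nonneg hs0] at hsd
      rw [hψ0, Real.dist_eq, sub_zero,
        abs_of_nonneg ((hφ0 s t hs0).trans (hlow s t hs0))]
      have h1 : φ (2 * s) t ≤ φ δ t := hmono t (by linarith)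
      linarith [hupp s t hs0, H t]
    · apply ContinuousAt.continuousWithinAt
      have hprim : Continuous fun b => ∫ u in (0 : ℝ)..b, φ u t :=
        intervalIntegral.continuous_primitive (hint' t) 0
      have heq : (fun s => s⁻¹ * ((∫ u in (0 : ℝ)..(s * 2), φ u t)
          - ∫ u in (0 : ℝ)..s, φ u t)) =ᶠ[𝓝 r] fun s => ψ s t := by
        filter_upwards [lt_mem_nhds hr] with s hs
        simp only [hψ]
        rw [intervalIntegral.integral_comp_mul_left (fun u => φ u t) hs.ne', mul_one,
          intervalIntegral.integral_interval_sub_left (hint' t _ _) (hint' t _ _), smul_eq_mul]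
      refine ContinuousAt.congr ?_ heq
      refine (continuousAt_inv₀ hr.ne').mul (ContinuousAt.sub ?_ hprim.continuousAt)
      exact (hprim.comp (continuous_id.mul continuous_const)).continuousAt
  refine ⟨fun r t => r * (1 + t)⁻¹ + ψ r t, ⟨fun t ht => ⟨?_, ?_, ?_⟩, fun r hr => ⟨?_, ?_⟩⟩,
    fun r t hr ht => ?_⟩
  · exact (continuousOn_id.mul continuousOn_const).add (hψcont t)
  · intro r hr r' hr' h
    have h1 : r * (1 + t)⁻¹ < r' * (1 + t)⁻¹ := mul_lt_mul_of_pos_right h (by positivity)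
    exact add_lt_add_of_lt_of_le h1 (hψmono t hr hr' h.le)
  · simp [hψ0]
  · intro t ht t' ht' h
    have ht0 : 0 ≤ t := ht
    have h1 : (1 + t')⁻¹ ≤ (1 + t)⁻¹ := inv_anti₀ (by linarith) (by linarith)
    refine add_le_add (mul_le_mul_of_nonneg_left h1 hr.le) ?_
    exact intervalIntegral.integral_mono_on (by norm_num) (hint r t' _ _ hr.le)
      (hint r t _ _ hr.le) fun u _ => hanti _ h
  · have h1 : Tendsto (fun t : ℝ => r * (1 + t)⁻¹) atTop (𝓝 (r * 0)) :=
      (tendsto_inv_atTop_zero.comp (tendsto_atTop_add_const_left _ 1 tendsto_id)).const_mul r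
    have h2 : Tendsto (fun t => ψ r t) atTop (𝓝 0) :=
      squeeze_zero (fun t => (hφ0 r t hr.le).trans (hlow r t hr.le))
        (fun t => hupp r t hr.le) (hlim (2 * r))
    simpa using h1.add h2
  · have : 0 ≤ r * (1 + t)⁻¹ := by positivity
    have := hlow r t hr
    dsimp only
    linarith

/-- If the triples (initial size, elapsed time, current size) in `Q` are bounded, stable and
attractive, uniformly in the initial size, then they admit a class `KL` estimate. -/
lemma exists_classKL_of_stable_of_attractive (Q : ℝ → ℕ → ℝ → Prop)
    (hQ : ∀ a n v, Q a n v → 0 ≤ a)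
    (hbdd : ∀ r : ℝ, ∃ M : ℝ, ∀ a n v, Q a n v → a ≤ r → v ≤ M)
    (hstab : ∀ ε : ℝ, 0 < ε → ∃ δ : ℝ, 0 < δ ∧ ∀ a n v, Q a n v → a ≤ δ → v ≤ ε)
    (hattr : ∀ r ε : ℝ, 0 < ε → ∃ T : ℕ, ∀ a n v, Q a n v → a ≤ r → T ≤ n → v ≤ ε) :
    ∃ β : ℝ → ℝ → ℝ, ClassKL β ∧ ∀ a n v, Q a n v → v ≤ β a n := by
  set S : ℝ → ℝ → Set ℝ :=
    fun r t => insert 0 {v | ∃ a n, Q a n v ∧ a ≤ r ∧ t ≤ ((n : ℕ) : ℝ)}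
  have hSbdd : ∀ r t, BddAbove (S r t) := fun r t => by
    obtain ⟨M, hM⟩ := hbdd r
    refine BddAbove.insert 0 ⟨M, ?_⟩
    rintro v ⟨a, n, hq, ha, -⟩
    exact hM a n v hq ha
  have hSne : ∀ r t, (S r t).Nonempty := fun r t => Set.insert_nonempty _ _
  have hnonneg : ∀ r t, 0 ≤ sSup (S r t) := fun r t =>
    le_csSup (hSbdd r t) (Set.mem_insert _ _)
  have hle : ∀ r t ε, 0 ≤ ε → (∀ a n v, Q a n v → a ≤ r → t ≤ ((n : ℕ) : ℝ) → v ≤ ε) →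
      sSup (S r t) ≤ ε := fun r t ε hε H => by
    refine csSup_le (hSne r t) ?_
    rintro v (rfl | ⟨a, n, hq, ha, hn⟩)
    exacts [hε, H a n v hq ha hn]
  have hmono : ∀ t, Monotone fun r => sSup (S r t) := fun t r r' h => by
    refine csSup_le_csSup (hSbdd r' t) (hSne r t) (Set.insert_subset_insert ?_)
    rintro v ⟨a, n, hq, ha, hn⟩
    exact ⟨a, n, hq, ha.trans h, hn⟩
  have hsmall : ∀ ε : ℝ, 0 < ε → ∃ δ : ℝ, 0 < δ ∧ ∀ t, sSup (S δ t) ≤ ε := fun ε hε => by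
    obtain ⟨δ, hδ, H⟩ := hstab ε hε
    exact ⟨δ, hδ, fun t => hle δ t ε hε.le fun a n v hq ha _ => H a n v hq ha⟩
  obtain ⟨β, hβ, H⟩ := exists_classKL_ge (φ := fun r t => sSup (S r t)) hmono
    (fun r t t' h => by
      refine csSup_le_csSup (hSbdd r t) (hSne r t') (Set.insert_subset_insert ?_)
      rintro v ⟨a, n, hq, ha, hn⟩
      exact ⟨a, n, hq, ha, h.trans hn⟩)
    (fun t => by
      refine le_antisymm (le_of_forall_pos_le_add fun ε hε => ?_) (hnonneg 0 t)
      obtain ⟨δ, hδ, H⟩ := hsmall ε hε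
      rw [zero_add]
      exact (hmono t hδ.le).trans (H t))
    hsmall
    (fun r => by
      rw [Metric.tendsto_atTop]
      intro ε hε
      obtain ⟨T, hT⟩ := hattr r (ε / 2) (half_pos hε)
      refine ⟨T, fun t ht => ?_⟩
      rw [Real.dist_eq, sub_zero, abs_of_nonneg (hnonneg r t)]
      have := hle r t (ε / 2) (half_pos hε).le fun a n v hq ha hn =>
        hT a n v hq ha (by exact_mod_cast ht.trans hn)
      linarith)
  refine ⟨β, hβ, fun a n v hq => ?_⟩
  exact (le_csSup (hSbdd a n) (Set.mem_insert_of_mem _ ⟨a, n, hq, le_rfl, le_rfl⟩)).trans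
    (H a n (hQ a n v hq) n.cast_nonneg)

end KL

section Solutions

/-- `w` solves `w(k+1) = F(k, w(k))` from time `k₀` on. -/
def IsSolution {G : Type*} (F : ℕ → G → G) (k₀ : ℕ) (w : ℕ → G) : Prop :=
  ∀ k, k₀ ≤ k → w (k + 1) = F k (w k)

lemma IsSolution.mono {G : Type*} {F : ℕ → G → G} {k₀ k₁ : ℕ} {w : ℕ → G}
    (h : IsSolution F k₀ w) (hk : k₀ ≤ k₁) : IsSolution F k₁ w :=
  fun k hk' => h k (hk.trans hk')

lemma exists_isSolution {G : Type*} (F : ℕ → G → G) (k₀ : ℕ) (w₀ : G) :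
    ∃ w, IsSolution F k₀ w ∧ w k₀ = w₀ := by
  refine ⟨fun k => Nat.rec (motive := fun _ => G) w₀ (fun n u => F (k₀ + n) u) (k - k₀), ?_, ?_⟩
  · intro k hk
    obtain ⟨n, rfl⟩ := Nat.exists_eq_add_of_le hk
    have h1 : k₀ + n + 1 - k₀ = n + 1 := by omega
    have h2 : k₀ + n - k₀ = n := by omega
    simp only [h1, h2]
  · simp

variable {G : Type*} [NormedAddCommGroup G] {F : ℕ → G → G}

lemma UGAS.bounded (h : UGAS F) (r : ℝ) :
    ∃ M : ℝ, ∀ k₀ w, IsSolution F k₀ w → ‖w k₀‖ ≤ r → ∀ k, k₀ ≤ k → ‖w k‖ ≤ M := by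
  obtain ⟨β, hβ, H⟩ := h
  refine ⟨max r (β r 1), fun k₀ w hw hr k hk => ?_⟩
  rcases hk.eq_or_lt with rfl | hlt
  · exact hr.trans (le_max_left _ _)
  · refine ((H k₀ w hw k hk).trans ?_).trans (le_max_right _ _)
    exact hβ.le_of_le_of_le (norm_nonneg _) hr one_pos
      (by exact_mod_cast (by omega : 1 ≤ k - k₀))

lemma UGAS.stable (h : UGAS F) {ε : ℝ} (hε : 0 < ε) :
    ∃ δ : ℝ, 0 < δ ∧ ∀ k₀ w, IsSolution F k₀ w → ‖w k₀‖ ≤ δ → ∀ k, k₀ ≤ k → ‖w k‖ ≤ ε := by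
  obtain ⟨β, hβ, H⟩ := h
  obtain ⟨δ, hδ, hδε⟩ := (hβ.1 1 one_pos).exists_le hε
  refine ⟨min δ ε, lt_min hδ hε, fun k₀ w hw hr k hk => ?_⟩
  rcases hk.eq_or_lt with rfl | hlt
  · exact hr.trans (min_le_right _ _)
  · refine ((H k₀ w hw k hk).trans ?_).trans hδε
    exact hβ.le_of_le_of_le (norm_nonneg _) (hr.trans (min_le_left _ _)) one_pos
      (by exact_mod_cast (by omega : 1 ≤ k - k₀))

lemma UGAS.attractive (h : UGAS F) (r : ℝ) {ε : ℝ} (hε : 0 < ε) :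
    ∃ T : ℕ, ∀ k₀ w, IsSolution F k₀ w → ‖w k₀‖ ≤ r → ∀ k, k₀ + T ≤ k → ‖w k‖ ≤ ε := by
  obtain ⟨β, hβ, H⟩ := h
  obtain ⟨T, hT, hTε⟩ := hβ.exists_nat_le (lt_max_of_lt_right one_pos : 0 < max r 1) hε
  refine ⟨T, fun k₀ w hw hr k hk => ?_⟩
  refine ((H k₀ w hw k (by omega)).trans ?_).trans hTε
  exact hβ.le_of_le_of_le (norm_nonneg _) (hr.trans (le_max_left _ _))
    (by exact_mod_cast hT) (by exact_mod_cast (by omega : T ≤ k - k₀))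

end Solutions

section Cascade

variable {E F : Type*} [NormedAddCommGroup E] [NormedAddCommGroup F]
  {f : ℕ → E → F → E} {g : ℕ → F → F}

/-- Continuity of `f` in `(x, y)` that is uniform in time. -/
def UniformInTimeContinuous (f : ℕ → E → F → E) : Prop :=
  ∀ (x : E) (y : F), ∀ ε : ℝ, 0 < ε → ∃ δ : ℝ, 0 < δ ∧ ∀ k : ℕ, ∀ (x' : E) (y' : F),
    jnorm (x' - x) (y' - y) ≤ δ → ‖f k x' y' - f k x y‖ ≤ ε

lemma UniformInTimeContinuous.uniform_on_closedBall [ProperSpace E]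
    (hf : UniformInTimeContinuous f) (M : ℝ) {ε : ℝ} (hε : 0 < ε) :
    ∃ η : ℝ, 0 < η ∧ ∀ k x x' y', ‖x‖ ≤ M → ‖x' - x‖ ≤ η → ‖y'‖ ≤ η →
      ‖f k x' y' - f k x 0‖ ≤ ε := by
  have key : ∃ η : ℝ, 0 < η ∧ ∀ x ∈ Metric.closedBall (0 : E) M, ∀ k x' y', ‖x' - x‖ ≤ η →
      ‖y'‖ ≤ η → ‖f k x' y' - f k x 0‖ ≤ ε := by
    refine (isCompact_closedBall (0 : E) M).induction_on
      (p := fun s => ∃ η : ℝ, 0 < η ∧ ∀ x ∈ s, ∀ k x' y', ‖x' - x‖ ≤ η →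
        ‖y'‖ ≤ η → ‖f k x' y' - f k x 0‖ ≤ ε) ⟨1, one_pos, by simp⟩ ?_ ?_ ?_
    · rintro s t hst ⟨η, hη, H⟩
      exact ⟨η, hη, fun x hx => H x (hst hx)⟩
    · rintro s t ⟨η, hη, H⟩ ⟨η', hη', H'⟩
      refine ⟨min η η', lt_min hη hη', ?_⟩
      rintro x (hx | hx) k x' y' h1 h2
      · exact H x hx k x' y' (h1.trans (min_le_left _ _)) (h2.trans (min_le_left _ _))
      · exact H' x hx k x' y' (h1.trans (min_le_right _ _)) (h2.trans (min_le_right _ _))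
    · intro z _
      obtain ⟨δ, hδ, H⟩ := hf z 0 (ε / 2) (half_pos hε)
      refine ⟨Metric.ball z (δ / 3),
        mem_nhdsWithin_of_mem_nhds (Metric.ball_mem_nhds z (by linarith)),
        δ / 3, by linarith, fun x hx k x' y' h1 h2 => ?_⟩
      rw [Metric.mem_ball, dist_eq_norm] at hx
      have ha : ‖f k x' y' - f k z 0‖ ≤ ε / 2 := by
        refine H k x' y' ((jnorm_le_add _ _).trans ?_)
        rw [sub_zero]
        linarith [norm_sub_le_norm_sub_add_norm_sub x' x z]
      have hb : ‖f k x 0 - f k z 0‖ ≤ ε / 2 := by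
        refine H k x 0 ((jnorm_le_add _ _).trans ?_)
        rw [sub_zero, norm_zero]
        linarith
      rw [norm_sub_rev] at hb
      linarith [norm_sub_le_norm_sub_add_norm_sub (f k x' y') (f k z 0) (f k x 0)]
  obtain ⟨η, hη, H⟩ := key
  exact ⟨η, hη, fun k x x' y' hx => H x (mem_closedBall_zero_iff.2 hx) k x' y'⟩

/-- On finite horizons, solutions driven by a small input stay close to zero-input solutions. -/
lemma exists_input_bound_of_close [ProperSpace E] (hf : UniformInTimeContinuous f)
    (hx : UGAS fun k x => f k x 0) (R : ℝ) (T : ℕ) {ε : ℝ} (hε : 0 < ε) :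
    ∃ δ : ℝ, 0 < δ ∧ ∀ (k₀ : ℕ) (x u : ℕ → E) (y : ℕ → F),
      IsSolution (fun k x => f k x (y k)) k₀ x →
      IsSolution (fun k x => f k x 0) k₀ u → u k₀ = x k₀ → ‖x k₀‖ ≤ R →
      (∀ k, k₀ ≤ k → ‖y k‖ ≤ δ) → ∀ n, n ≤ T → ‖x (k₀ + n) - u (k₀ + n)‖ ≤ ε := by
  obtain ⟨M, hM⟩ := hx.bounded R
  induction T generalizing ε with
  | zero =>
    refine ⟨1, one_pos, fun k₀ x u y _ _ h0 _ _ n hn => ?_⟩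
    obtain rfl : n = 0 := by omega
    simpa [h0] using hε.le
  | succ T ih =>
    obtain ⟨η, hη, H⟩ := hf.uniform_on_closedBall M hε
    obtain ⟨δ, hδ, Hδ⟩ := ih (lt_min hη hε)
    refine ⟨min δ η, lt_min hδ hη, fun k₀ x u y hxs hus h0 hR hy n hn => ?_⟩
    have hclose := Hδ k₀ x u y hxs hus h0 hR fun k hk => (hy k hk).trans (min_le_left _ _)
    rcases hn.eq_or_lt with rfl | hlt
    · rw [← add_assoc, hxs _ (Nat.le_add_right _ _), hus _ (Nat.le_add_right _ _)]
      exact H _ _ _ _ (hM k₀ u hus (h0 ▸ hR) _ (Nat.le_add_right _ _))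
        ((hclose T le_rfl).trans (min_le_left _ _))
        ((hy _ (Nat.le_add_right _ _)).trans (min_le_right _ _))
    · exact (hclose n (by omega)).trans (min_le_right _ _)

lemma exists_input_bound_of_small [ProperSpace E] (hf : UniformInTimeContinuous f)
    (hx : UGAS fun k x => f k x 0) {ε : ℝ} (hε : 0 < ε) :
    ∃ δ : ℝ, 0 < δ ∧ ∀ (k₀ : ℕ) (x : ℕ → E) (y : ℕ → F),
      IsSolution (fun k x => f k x (y k)) k₀ x → ‖x k₀‖ ≤ δ →
      (∀ k, k₀ ≤ k → ‖y k‖ ≤ δ) → ∀ k, k₀ ≤ k → ‖x k‖ ≤ ε := by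
  obtain ⟨δ, hδ, hstab⟩ := hx.stable (half_pos hε)
  set ρ := min δ ε
  have hρ0 : 0 < ρ := lt_min hδ hε
  obtain ⟨T, hT⟩ := hx.attractive ρ (half_pos hρ0)
  obtain ⟨δ', hδ', hclose⟩ := exists_input_bound_of_close hf hx ρ (T + 1) (half_pos hρ0)
  refine ⟨min ρ δ', lt_min hρ0 hδ', fun k₀ x y hxs hx0 hy => ?_⟩
  have hblock : ∀ k₁, k₀ ≤ k₁ → ‖x k₁‖ ≤ ρ →
      (∀ n, n ≤ T + 1 → ‖x (k₁ + n)‖ ≤ ε) ∧ ‖x (k₁ + (T + 1))‖ ≤ ρ := by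
    intro k₁ hk₁ hxk
    obtain ⟨u, hus, hu0⟩ := exists_isSolution (fun k x => f k x 0) k₁ (x k₁)
    have hc := hclose k₁ x u y (hxs.mono hk₁) hus hu0 hxk
      fun k hk => (hy k (hk₁.trans hk)).trans (min_le_right _ _)
    have htri : ∀ n, ‖x (k₁ + n)‖ ≤ ‖x (k₁ + n) - u (k₁ + n)‖ + ‖u (k₁ + n)‖ := fun n =>
      norm_le_norm_sub_add _ _
    have hρε : ρ ≤ ε := min_le_right _ _
    refine ⟨fun n hn => ?_, ?_⟩
    · have := hstab k₁ u hus (hu0 ▸ hxk.trans (min_le_left _ _)) (k₁ + n) (Nat.le_add_right _ _)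
      linarith [htri n, hc n hn]
    · have := hT k₁ u hus (hu0 ▸ hxk) (k₁ + (T + 1)) (by omega)
      linarith [htri (T + 1), hc (T + 1) le_rfl]
  have hgrid : ∀ m, ‖x (k₀ + m * (T + 1))‖ ≤ ρ := by
    intro m
    induction m with
    | zero => simpa using hx0.trans (min_le_left _ _)
    | succ m ih =>
      rw [Nat.succ_mul, ← add_assoc]
      exact (hblock _ (Nat.le_add_right _ _) ih).2
  intro k hk
  have hdecomp : k = k₀ + (k - k₀) / (T + 1) * (T + 1) + (k - k₀) % (T + 1) := by
    have := Nat.div_add_mod' (k - k₀) (T + 1)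
    omega
  rw [hdecomp]
  exact (hblock _ (Nat.le_add_right _ _) (hgrid _)).1 _ (Nat.mod_lt _ T.succ_pos).le

lemma CascadeUGAS.map_zero (h : CascadeUGAS f g) (k : ℕ) : g k 0 = 0 := by
  obtain ⟨β, hβ, H⟩ := h
  obtain ⟨y, hy, hy0⟩ := exists_isSolution g k 0
  obtain ⟨x, hx, hx0⟩ := exists_isSolution (fun k x => f k x (y k)) k 0
  have h1 := H k x y hx hy (k + 1) (Nat.le_succ k)
  have h0 : β 0 ((k + 1 - k : ℕ) : ℝ) = 0 := (hβ.1 _ (by simp)).2.2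
  rw [hx0, hy0, jnorm_zero_left, norm_zero, h0, hy k le_rfl, hy0] at h1
  exact norm_le_zero_iff.1 ((norm_le_jnorm_right _ _).trans h1)

lemma CascadeUGAS.zero_input (h : CascadeUGAS f g) : UGAS fun k x => f k x 0 := by
  have hg := h.map_zero
  obtain ⟨β, hβ, H⟩ := h
  refine ⟨β, hβ, fun k₀ w hw k hk => ?_⟩
  simpa only [jnorm_zero_right] using H k₀ w (fun _ => 0) hw (fun k _ => (hg k).symm) k hk

lemma CascadeUGAS.driving (h : CascadeUGAS f g) : UGAS g := by
  obtain ⟨β, hβ, H⟩ := h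
  refine ⟨β, hβ, fun k₀ w hw k hk => ?_⟩
  obtain ⟨x, hx, hx0⟩ := exists_isSolution (fun k x => f k x (w k)) k₀ 0
  have := H k₀ x w hx hw k hk
  rw [hx0, jnorm_zero_left] at this
  exact (norm_le_jnorm_right _ _).trans this

lemma CascadeUGAS.cascadeUGB (h : CascadeUGAS f g) : CascadeUGB f g := by
  obtain ⟨β, hβ, H⟩ := h
  have hK := hβ.1 1 one_pos
  refine ⟨fun s => s + β s 1, 0, ⟨⟨continuousOn_id.add hK.1,
    fun r hr r' hr' hlt => add_lt_add hlt (hK.2.1 hr hr' hlt), by simpa using hK.2.2⟩,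
    fun M => ⟨|M| + 1, by positivity, ?_⟩⟩, le_rfl, fun k₀ x y hx hy k hk => ?_⟩
  · have := hK.nonneg (s := |M| + 1) (by positivity)
    dsimp only at this ⊢
    linarith [le_abs_self M]
  · have h0 := jnorm_nonneg (x k₀) (y k₀)
    have h1 := hK.nonneg h0
    dsimp only at h1 ⊢
    rcases hk.eq_or_lt with rfl | hlt
    · linarith
    · have h2 := hβ.le_of_le h0 one_pos
        (by exact_mod_cast (by omega : 1 ≤ k - k₀) : (1 : ℝ) ≤ ((k - k₀ : ℕ) : ℝ))
      linarith [H k₀ x y hx hy k hk]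

lemma cascadeUGAS_of_UGAS_of_UGB [ProperSpace E] (hf : UniformInTimeContinuous f)
    (hx : UGAS fun k x => f k x 0) (hg : UGAS g) (hb : CascadeUGB f g) : CascadeUGAS f g := by
  have hbdd : ∀ r : ℝ, ∃ M : ℝ, ∀ (k₀ : ℕ) (x : ℕ → E) (y : ℕ → F),
      IsSolution (fun k x => f k x (y k)) k₀ x →
      IsSolution g k₀ y → jnorm (x k₀) (y k₀) ≤ r → ∀ k, k₀ ≤ k → jnorm (x k) (y k) ≤ M := by
    obtain ⟨κ, c, hκ, -, H⟩ := hb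
    refine fun r => ⟨κ r + c, fun k₀ x y hxs hys hr k hk => (H k₀ x y hxs hys k hk).trans ?_⟩
    have h0 := jnorm_nonneg (x k₀) (y k₀)
    have := hκ.1.monotoneOn (Set.mem_Ici.2 h0) (Set.mem_Ici.2 (h0.trans hr)) hr
    linarith
  have hstab : ∀ ε : ℝ, 0 < ε → ∃ δ : ℝ, 0 < δ ∧ ∀ k₀ x y,
      IsSolution (fun k x => f k x (y k)) k₀ x → IsSolution g k₀ y →
      jnorm (x k₀) (y k₀) ≤ δ → ∀ k, k₀ ≤ k → jnorm (x k) (y k) ≤ ε := by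
    intro ε hε
    obtain ⟨δ, hδ, H⟩ := exists_input_bound_of_small hf hx (half_pos hε)
    obtain ⟨δ', hδ', H'⟩ := hg.stable (lt_min hδ (half_pos hε))
    refine ⟨min δ δ', lt_min hδ hδ', fun k₀ x y hxs hys h0 k hk => ?_⟩
    have hy := H' k₀ y hys ((norm_le_jnorm_right _ _).trans (h0.trans (min_le_right _ _)))
    have := H k₀ x y hxs ((norm_le_jnorm_left _ _).trans (h0.trans (min_le_left _ _)))
      (fun k hk => (hy k hk).trans (min_le_left _ _)) k hk
    linarith [jnorm_le_add (x k) (y k), (hy k hk).trans (min_le_right _ _)]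
  have hattr : ∀ r ε : ℝ, 0 < ε → ∃ T : ℕ, ∀ k₀ x y,
      IsSolution (fun k x => f k x (y k)) k₀ x → IsSolution g k₀ y →
      jnorm (x k₀) (y k₀) ≤ r → ∀ k, k₀ + T ≤ k → jnorm (x k) (y k) ≤ ε := by
    intro r ε hε
    obtain ⟨R, hR⟩ := hbdd r
    obtain ⟨δ, hδ, hδs⟩ := hstab ε hε
    obtain ⟨T₂, hT₂⟩ := hx.attractive R (by linarith : 0 < δ / 3)
    obtain ⟨η, hη, hclose⟩ := exists_input_bound_of_close hf hx R T₂ (by linarith : 0 < δ / 3)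
    obtain ⟨T₁, hT₁⟩ := hg.attractive r (lt_min hη (by linarith : 0 < δ / 3))
    refine ⟨T₁ + T₂, fun k₀ x y hxs hys h0 k hk => ?_⟩
    have hy := hT₁ k₀ y hys ((norm_le_jnorm_right _ _).trans h0)
    have hxR : ‖x (k₀ + T₁)‖ ≤ R :=
      (norm_le_jnorm_left _ _).trans (hR k₀ x y hxs hys h0 _ (Nat.le_add_right _ _))
    obtain ⟨u, hus, hu0⟩ := exists_isSolution (fun k x => f k x 0) (k₀ + T₁) (x (k₀ + T₁))
    have h1 := hclose _ x u y (hxs.mono (Nat.le_add_right _ _)) hus hu0 hxR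
      (fun k hk => (hy k hk).trans (min_le_left _ _)) T₂ le_rfl
    have h2 := hT₂ _ u hus (hu0 ▸ hxR) _ le_rfl
    refine hδs (k₀ + T₁ + T₂) x y (hxs.mono (by omega)) (hys.mono (by omega)) ?_ k (by omega)
    have h3 := (hy (k₀ + T₁ + T₂) (Nat.le_add_right _ _)).trans (min_le_right _ _)
    linarith [jnorm_le_add (x (k₀ + T₁ + T₂)) (y (k₀ + T₁ + T₂)),
      norm_le_norm_sub_add (x (k₀ + T₁ + T₂)) (u (k₀ + T₁ + T₂))]
  obtain ⟨β, hβ, H⟩ := exists_classKL_of_stable_of_attractive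
    (fun a n v => ∃ k₀ x y, IsSolution (fun k x => f k x (y k)) k₀ x ∧ IsSolution g k₀ y ∧
      a = jnorm (x k₀) (y k₀) ∧ v = jnorm (x (k₀ + n)) (y (k₀ + n)))
    (by
      rintro a n v ⟨k₀, x, y, -, -, rfl, -⟩
      exact jnorm_nonneg _ _)
    (fun r => by
      obtain ⟨M, hM⟩ := hbdd r
      refine ⟨M, ?_⟩
      rintro a n v ⟨k₀, x, y, hxs, hys, rfl, rfl⟩ ha
      exact hM k₀ x y hxs hys ha _ (Nat.le_add_right _ _))
    (fun ε hε => by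
      obtain ⟨δ, hδ, H⟩ := hstab ε hε
      refine ⟨δ, hδ, ?_⟩
      rintro a n v ⟨k₀, x, y, hxs, hys, rfl, rfl⟩ ha
      exact H k₀ x y hxs hys ha _ (Nat.le_add_right _ _))
    (fun r ε hε => by
      obtain ⟨T, hT⟩ := hattr r ε hε
      refine ⟨T, ?_⟩
      rintro a n v ⟨k₀, x, y, hxs, hys, rfl, rfl⟩ ha hn
      exact hT k₀ x y hxs hys ha _ (by omega))
  refine ⟨β, hβ, fun k₀ x y hxs hys k hk => ?_⟩
  exact H _ _ _ ⟨k₀, x, y, hxs, hys, rfl, by rw [Nat.add_sub_cancel' hk]⟩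

end Cascade

/-- Corollary 1: if `f` is continuous in `(x,y)` uniformly in `k`, the cascade
is UGAS iff the zero-input subsystem is UGAS, the `y`-subsystem is UGAS, and the cascade is
UGB. -/
theorem stmt3 (nx ny : ℕ)
    (f : ℕ → EuclideanSpace ℝ (Fin nx) → EuclideanSpace ℝ (Fin ny) →
      EuclideanSpace ℝ (Fin nx))
    (g : ℕ → EuclideanSpace ℝ (Fin ny) → EuclideanSpace ℝ (Fin ny))
    (hf : ∀ (x : EuclideanSpace ℝ (Fin nx)) (y : EuclideanSpace ℝ (Fin ny)),
      ∀ ε : ℝ, 0 < ε → ∃ δ : ℝ, 0 < δ ∧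
        ∀ k : ℕ, ∀ (x' : EuclideanSpace ℝ (Fin nx)) (y' : EuclideanSpace ℝ (Fin ny)),
          jnorm (x' - x) (y' - y) ≤ δ → ‖f k x' y' - f k x y‖ ≤ ε) :
    CascadeUGAS f g ↔
      (UGAS (fun k x => f k x 0) ∧ UGAS g ∧ CascadeUGB f g) := by
  exact ⟨fun h => ⟨h.zero_input, h.driving, h.cascadeUGB⟩,
    fun ⟨hx, hg, hb⟩ => cascadeUGAS_of_UGAS_of_UGB hf hx hg hb⟩
end

section
/- Consider the parameterized x-subsystem x(k+1)=f_T(k,x(k),z(k)) with input z. Suppose that the zero-input subsystem x(k+1)=f_T(k,x(k),0) is SP-UAS and that for every pair of strictly positive reals (Δ₁,Δ₂) there exist strictly positive K,T* such that for all k≥0, all max{|x₁|,|x₂|}≤Δ₁, all max{|z₁|,|z₂|}≤Δ₂ and all T∈(0,T*): |f_T(k,x₁,z₁)−f_T(k,x₂,z₁)| ≤ (1+KT)|x₁−x₂| and |f_T(k,x₁,z₁)−f_T(k,x₁,z₂)| ≤ KT|z₁−z₂|. Then the solutions of the x-subsystem with input z are USC. -/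
open Filter Topology

/-- SP-UAS of a parameterized discrete-time system `y(k+1) = F_T(k, y(k))`. -/
def SPUAS {G : Type*} [NormedAddCommGroup G] (F : ℝ → ℕ → G → G) : Prop :=
  ∃ β : ℝ → ℝ → ℝ, ClassKL β ∧
    ∀ Δ ν : ℝ, 0 < Δ → 0 < ν → ∃ Tstar : ℝ, 0 < Tstar ∧
      ∀ T : ℝ, 0 < T → T < Tstar →
        ∀ k₀ : ℕ, ∀ y : ℕ → G, (∀ k, k₀ ≤ k → y (k + 1) = F T k (y k)) → ‖y k₀‖ ≤ Δ →
          ∀ k, k₀ ≤ k → ‖y k‖ ≤ max (β ‖y k₀‖ (((k - k₀ : ℕ) : ℝ) * T)) ν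

/-- SP-UAS of the parameterized cascade `x(k+1)=f_T(k,x,z)`, `z(k+1)=g_T(k,z)`,
with the Euclidean norm of the joint state. -/
def CascadeSPUAS {E F : Type*} [NormedAddCommGroup E] [NormedAddCommGroup F]
    (f : ℝ → ℕ → E → F → E) (g : ℝ → ℕ → F → F) : Prop :=
  ∃ β : ℝ → ℝ → ℝ, ClassKL β ∧
    ∀ Δ ν : ℝ, 0 < Δ → 0 < ν → ∃ Tstar : ℝ, 0 < Tstar ∧
      ∀ T : ℝ, 0 < T → T < Tstar →
        ∀ k₀ : ℕ, ∀ x : ℕ → E, ∀ z : ℕ → F,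
          (∀ k, k₀ ≤ k → x (k + 1) = f T k (x k) (z k)) →
          (∀ k, k₀ ≤ k → z (k + 1) = g T k (z k)) →
          jnorm (x k₀) (z k₀) ≤ Δ →
          ∀ k, k₀ ≤ k →
            jnorm (x k) (z k) ≤ max (β (jnorm (x k₀) (z k₀)) (((k - k₀ : ℕ) : ℝ) * T)) ν

/-- Uniform semiglobal boundedness (USB) of the parameterized cascade. -/
def CascadeUSB {E F : Type*} [NormedAddCommGroup E] [NormedAddCommGroup F]
    (f : ℝ → ℕ → E → F → E) (g : ℝ → ℕ → F → F) : Prop :=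
  ∃ κ : ℝ → ℝ, ∃ c : ℝ, ClassKInfty κ ∧ 0 ≤ c ∧
    ∀ Δ : ℝ, 0 < Δ → ∃ Tstar : ℝ, 0 < Tstar ∧
      ∀ T : ℝ, 0 < T → T < Tstar →
        ∀ k₀ : ℕ, ∀ x : ℕ → E, ∀ z : ℕ → F,
          (∀ k, k₀ ≤ k → x (k + 1) = f T k (x k) (z k)) →
          (∀ k, k₀ ≤ k → z (k + 1) = g T k (z k)) →
          jnorm (x k₀) (z k₀) ≤ Δ →
          ∀ k, k₀ ≤ k → jnorm (x k) (z k) ≤ κ (jnorm (x k₀) (z k₀)) + c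

/-- Uniform semiglobal continuity (USC) of the solutions of `x(k+1)=f_T(k,x,z)`
with respect to the input `z`. -/
def USC {E F : Type*} [NormedAddCommGroup E] [NormedAddCommGroup F]
    (f : ℝ → ℕ → E → F → E) : Prop :=
  ∀ Δ : ℝ, 0 < Δ → ∃ Tstar : ℝ, 0 < Tstar ∧
    ∀ η ε L : ℝ, 0 < η → η < Δ → 0 < ε → 0 < L → ∃ μ : ℝ, 0 < μ ∧
      ∀ T : ℝ, 0 < T → T < Tstar →
        ∀ z : ℕ → F, (∀ k, ‖z k‖ ≤ μ) →
          ∀ k₀ : ℕ, ∀ xz x0 : ℕ → E,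
            (∀ k, k₀ ≤ k → xz (k + 1) = f T k (xz k) (z k)) →
            (∀ k, k₀ ≤ k → x0 (k + 1) = f T k (x0 k) 0) →
            xz k₀ = x0 k₀ → ‖xz k₀‖ ≤ η →
            ∀ k, k₀ ≤ k → k ≤ k₀ + Nat.floor (L / T) → ‖xz k - x0 k‖ ≤ ε

/-- Away from `t = 0`, a class `KL` function is bounded on `[0, Δ]` by its value at `(Δ, 0)`. -/
theorem ClassKL.le_of_le_s5 {β : ℝ → ℝ → ℝ} (hβ : ClassKL β) {s t Δ : ℝ} (hs : 0 ≤ s) (hsΔ : s ≤ Δ)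
    (hΔ : 0 < Δ) (ht : 0 < t) : β s t ≤ β Δ 0 :=
  ((hβ.1 t ht).2.1.monotoneOn hs hΔ.le hsΔ).trans
    ((hβ.2 Δ hΔ).1 (Set.mem_Ici.2 le_rfl) (Set.mem_Ici.2 ht.le) ht.le)

/-- Trajectories of an SP-UAS system starting in a ball are uniformly bounded for small `T`. -/
theorem SPUAS.exists_bound {G : Type*} [NormedAddCommGroup G] {F : ℝ → ℕ → G → G}
    (hF : SPUAS F) {Δ : ℝ} (hΔ : 0 < Δ) :
    ∃ R Tstar : ℝ, 0 < R ∧ 0 < Tstar ∧ ∀ T : ℝ, 0 < T → T < Tstar →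
      ∀ k₀ : ℕ, ∀ y : ℕ → G, (∀ k, k₀ ≤ k → y (k + 1) = F T k (y k)) → ‖y k₀‖ ≤ Δ →
        ∀ k, k₀ ≤ k → ‖y k‖ ≤ R := by
  obtain ⟨β, hβ, h⟩ := hF
  obtain ⟨Tstar, hTstar, h⟩ := h Δ 1 hΔ one_pos
  refine ⟨max Δ (max (β Δ 0) 1), Tstar, lt_max_of_lt_left hΔ, hTstar, ?_⟩
  intro T hT hTlt k₀ y hy hy₀ k hk
  rcases hk.eq_or_lt with rfl | hlt
  · exact le_max_of_le_left hy₀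
  · refine le_max_of_le_right ((h T hT hTlt k₀ y hy hy₀ k hk).trans (max_le_max_right 1 ?_))
    refine hβ.le_of_le_s5 (norm_nonneg _) hy₀ hΔ (mul_pos ?_ hT)
    exact_mod_cast Nat.sub_pos_of_lt hlt

/-- Compound growth over at most `L / T` steps of size `T` is at most exponential in `L`. -/
theorem one_add_mul_pow_le_exp {K T L : ℝ} (hK : 0 < K) (hT : 0 < T) {j : ℕ}
    (hj : (j : ℝ) * T ≤ L) : (1 + K * T) ^ j ≤ Real.exp (K * L) := by
  calc (1 + K * T) ^ j ≤ Real.exp (K * T) ^ j := by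
        gcongr
        linarith [Real.add_one_le_exp (K * T)]
    _ = Real.exp (K * (j * T)) := by rw [← Real.exp_nat_mul]; ring_nf
    _ ≤ Real.exp (K * L) := by gcongr

/-- Proposition 1: if the zero-input subsystem is SP-UAS and `f_T` satisfies the
semiglobal Lipschitz-type conditions in `x` and `z`, then the solutions of the `x`-subsystem
with input `z` are USC. -/
theorem stmt5 (nx nz : ℕ)
    (f : ℝ → ℕ → EuclideanSpace ℝ (Fin nx) → EuclideanSpace ℝ (Fin nz) →
      EuclideanSpace ℝ (Fin nx))
    (hspuas : SPUAS (fun T k x => f T k x 0))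
    (hlip : ∀ Δ₁ Δ₂ : ℝ, 0 < Δ₁ → 0 < Δ₂ → ∃ K Tstar : ℝ, 0 < K ∧ 0 < Tstar ∧
      ∀ T : ℝ, 0 < T → T < Tstar → ∀ k : ℕ,
        ∀ x₁ x₂ : EuclideanSpace ℝ (Fin nx), ∀ z₁ z₂ : EuclideanSpace ℝ (Fin nz),
          ‖x₁‖ ≤ Δ₁ → ‖x₂‖ ≤ Δ₁ → ‖z₁‖ ≤ Δ₂ → ‖z₂‖ ≤ Δ₂ →
          ‖f T k x₁ z₁ - f T k x₂ z₁‖ ≤ (1 + K * T) * ‖x₁ - x₂‖ ∧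
          ‖f T k x₁ z₁ - f T k x₁ z₂‖ ≤ K * T * ‖z₁ - z₂‖) :
    USC f := by
  intro Δ hΔ
  obtain ⟨R, T₁, hR, hT₁, hbound⟩ := hspuas.exists_bound hΔ
  obtain ⟨K, T₂, hK, hT₂, hlip⟩ := hlip (R + 1) 1 (by linarith) one_pos
  refine ⟨min T₁ T₂, lt_min hT₁ hT₂, ?_⟩
  intro η ε L _ hηΔ hε hL
  have hδ : 0 < min ε 1 := lt_min hε one_pos
  set μ := min ε 1 * Real.exp (-(K * L)) with hμ
  have hμpos : 0 < μ := by positivity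
  have hμexp : μ * Real.exp (K * L) = min ε 1 := by
    rw [hμ, mul_assoc, ← Real.exp_add, neg_add_cancel, Real.exp_zero, mul_one]
  have hμ_one : μ ≤ 1 := by
    have : 1 ≤ Real.exp (K * L) := Real.one_le_exp (by positivity)
    nlinarith [min_le_right ε 1]
  refine ⟨μ, hμpos, ?_⟩
  intro T hT hTlt z hz k₀ xz x0 hxz hx0 heq hη
  have hx0R : ∀ k, k₀ ≤ k → ‖x0 k‖ ≤ R :=
    hbound T hT (hTlt.trans_le (min_le_left _ _)) k₀ x0 hx0 (heq ▸ hη.trans hηΔ.le)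
  have hgrowth : ∀ j : ℕ, (j : ℝ) * T ≤ L → μ * ((1 + K * T) ^ j - 1) ≤ min ε 1 := by
    intro j hj
    have := mul_le_mul_of_nonneg_left (one_add_mul_pow_le_exp hK hT hj) hμpos.le
    linarith
  have hmain : ∀ j : ℕ, (j : ℝ) * T ≤ L →
      ‖xz (k₀ + j) - x0 (k₀ + j)‖ ≤ μ * ((1 + K * T) ^ j - 1) := by
    intro j
    induction j with
    | zero => simp [heq]
    | succ j ih =>
      intro hj
      have hj' : (j : ℝ) * T ≤ L := by
        push_cast at hj
        linarith
      have he := ih hj'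
      have he_one : ‖xz (k₀ + j) - x0 (k₀ + j)‖ ≤ 1 :=
        (he.trans (hgrowth j hj')).trans (min_le_right _ _)
      have hx0j := hx0R (k₀ + j) (Nat.le_add_right _ _)
      have hxzj : ‖xz (k₀ + j)‖ ≤ R + 1 := by
        linarith [norm_le_norm_add_norm_sub' (xz (k₀ + j)) (x0 (k₀ + j))]
      have hlipT := hlip T hT (hTlt.trans_le (min_le_right _ _)) (k₀ + j)
      have hzj : ‖z (k₀ + j)‖ ≤ 1 := (hz _).trans hμ_one
      have hstate := (hlipT (xz (k₀ + j)) (x0 (k₀ + j)) (z (k₀ + j)) 0 hxzj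
        (by linarith) hzj (by simp)).1
      have hinput := (hlipT (x0 (k₀ + j)) (x0 (k₀ + j)) (z (k₀ + j)) 0
        (by linarith) (by linarith) hzj (by simp)).2
      rw [sub_zero] at hinput
      rw [← add_assoc, hxz _ (Nat.le_add_right _ _), hx0 _ (Nat.le_add_right _ _)]
      calc _ ≤ _ := norm_sub_le_norm_sub_add_norm_sub _
              (f T (k₀ + j) (x0 (k₀ + j)) (z (k₀ + j))) _
        _ ≤ (1 + K * T) * ‖xz (k₀ + j) - x0 (k₀ + j)‖ + K * T * ‖z (k₀ + j)‖ :=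
            add_le_add hstate hinput
        _ ≤ (1 + K * T) * (μ * ((1 + K * T) ^ j - 1)) + K * T * μ := by
            gcongr
            exact hz _
        _ = μ * ((1 + K * T) ^ (j + 1) - 1) := by ring
  intro k hk hkL
  obtain ⟨j, rfl⟩ := Nat.exists_eq_add_of_le hk
  have hj : (j : ℝ) * T ≤ L :=
    (le_div_iff₀ hT).1 ((Nat.le_floor_iff (by positivity)).1 (Nat.le_of_add_le_add_left hkL))
  exact ((hmain j hj).trans (hgrowth j hj)).trans (min_le_left _ _)
end

section
/- Consider the parameterized cascade x(k+1)=f_T(k,x(k),z(k)), z(k+1)=g_T(k,z(k)), and suppose the x-subsystem satisfies the Lyapunov growth assumption with data (α̃₁,α̃₂,φ,γ̃₁,γ̃₂,c,T*). Define μ(s):=γ̃₁(s)+γ̃₂(s)/φ(1). If furthermore the solutions of the z-subsystem satisfy the summability condition T·Σ_{k=k₀}^{∞} μ(|φ^z_T(k,k₀,z₀)|) ≤ ρ(|z₀|) for some ρ of class K∞, uniformly over k₀≥0 and T∈(0,T*), then the x-component of the cascade is UGB: there exist κ of class K∞ and c'≥0 and T̃>0 such that for all k₀≥0, all initial conditions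 ξ₀=(x₀,z₀) and all T∈(0,T̃), the x-component of the cascade solution satisfies |φ^x_T(k,k₀,ξ₀)| ≤ κ(|ξ₀|)+c' for all k≥k₀. -/
open Filter Topology

open MeasureTheory

/-- A monotone function is dominated on `[0,∞)` by a class `K∞` function plus a constant. -/
theorem Monotone.exists_classKInfty_bound {B : ℝ → ℝ} (hB : Monotone B) :
    ∃ κ : ℝ → ℝ, ∃ c' : ℝ, ClassKInfty κ ∧ 0 ≤ c' ∧ ∀ s, 0 ≤ s → B s ≤ κ s + c' := by
  have hint : ∀ a b, IntervalIntegrable B volume a b := fun a b => hB.intervalIntegrable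
  have hshift : ∀ s, IntervalIntegrable (fun t => B (s + t)) volume 0 1 := fun s =>
    (hB.comp (monotone_id.const_add s)).intervalIntegrable
  set A : ℝ → ℝ := fun s => ∫ t in (0 : ℝ)..1, B (s + t) with hA
  have hAmono : Monotone A := fun a b hab =>
    intervalIntegral.integral_mono_on zero_le_one (hshift a) (hshift b)
      fun t _ => hB (by linarith)
  have hAcont : Continuous A := by
    have hprim : Continuous fun s => ∫ t in (0 : ℝ)..s, B t :=
      intervalIntegral.continuous_primitive hint 0
    have heq : A = fun s => (∫ t in (0 : ℝ)..(s + 1), B t) - ∫ t in (0 : ℝ)..s, B t := by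
      funext s
      rw [intervalIntegral.integral_interval_sub_left (hint _ _) (hint _ _)]
      simp [hA]
    rw [heq]
    exact (hprim.comp (continuous_id.add continuous_const)).sub hprim
  have hBA : ∀ s, B s ≤ A s := fun s => by
    have h := intervalIntegral.integral_mono_on zero_le_one
      (intervalIntegrable_const (μ := volume) (c := B s)) (hshift s)
      fun t ht => hB (by linarith [ht.1])
    simpa [hA, -intervalIntegral.integral_comp_add_left] using h
  refine ⟨fun s => s + (A s - A 0), |A 0|, ⟨⟨?_, ?_, by simp⟩, fun M => ?_⟩, abs_nonneg _,
    fun s hs => ?_⟩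
  · fun_prop
  · intro a _ b _ hab
    have := hAmono hab.le
    show a + (A a - A 0) < b + (A b - A 0)
    linarith
  · refine ⟨|M| + 1, by positivity, ?_⟩
    have := hAmono (show (0 : ℝ) ≤ |M| + 1 by positivity)
    linarith [le_abs_self M]
  · linarith [hBA s, le_abs_self (A 0)]

/-- Local bounds over the balls of natural radius are dominated by a class `K∞` function plus a
constant. -/
theorem exists_classKInfty_bound_of_nat {ι : Type*} {p q : ι → ℝ} (hp : ∀ i, 0 ≤ p i)
    (h : ∀ n : ℕ, ∃ M : ℝ, ∀ i, p i ≤ n → q i ≤ M) :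
    ∃ κ : ℝ → ℝ, ∃ c' : ℝ, ClassKInfty κ ∧ 0 ≤ c' ∧ ∀ i, q i ≤ κ (p i) + c' := by
  choose M hM using h
  have hB : Monotone fun s : ℝ => ∑ j ∈ Finset.range (⌈s⌉₊ + 1), |M j| := fun a b hab =>
    Finset.sum_le_sum_of_subset_of_nonneg
      (Finset.range_mono (Nat.add_le_add_right (Nat.ceil_mono hab) 1))
      fun _ _ _ => abs_nonneg _
  obtain ⟨κ, c', hκ, hc', hbound⟩ := hB.exists_classKInfty_bound
  refine ⟨κ, c', hκ, hc', fun i => ?_⟩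
  calc q i ≤ M ⌈p i⌉₊ := hM _ i (Nat.le_ceil _)
    _ ≤ |M ⌈p i⌉₊| := le_abs_self _
    _ ≤ ∑ j ∈ Finset.range (⌈p i⌉₊ + 1), |M j| :=
      Finset.single_le_sum (f := fun j => |M j|) (fun _ _ => abs_nonneg _) (by simp)
    _ ≤ κ (p i) + c' := hbound _ (hp i)

namespace ClassKInfty

variable {φ : ℝ → ℝ}

theorem pos (hφ : ClassKInfty φ) {s : ℝ} (hs : 0 < s) : 0 < φ s := by
  have := hφ.1.2.1 (Set.mem_Ici.2 le_rfl) (Set.mem_Ici.2 hs.le) hs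
  rwa [hφ.1.2.2] at this

theorem mono (hφ : ClassKInfty φ) {a b : ℝ} (ha : 0 ≤ a) (hab : a ≤ b) : φ a ≤ φ b :=
  hφ.1.2.1.monotoneOn (Set.mem_Ici.2 ha) (Set.mem_Ici.2 (ha.trans hab)) hab

theorem continuousOn_one_div (hφ : ClassKInfty φ) : ContinuousOn (fun s => 1 / φ s) (Set.Ici 1) :=
  continuousOn_const.div (hφ.1.1.mono (Set.Ici_subset_Ici.2 zero_le_one))
    fun _ hs => (hφ.pos (zero_lt_one.trans_le hs)).ne'

theorem intervalIntegrable_one_div (hφ : ClassKInfty φ) {a b : ℝ} (ha : 1 ≤ a) (hb : 1 ≤ b) :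
    IntervalIntegrable (fun s => 1 / φ s) volume a b :=
  (hφ.continuousOn_one_div.mono fun _ hs => (le_min ha hb).trans hs.1).intervalIntegrable

theorem integral_one_div_nonneg (hφ : ClassKInfty φ) {a b : ℝ} (ha : 1 ≤ a) (hab : a ≤ b) :
    0 ≤ ∫ s in a..b, 1 / φ s :=
  intervalIntegral.integral_nonneg hab fun _ hs =>
    (one_div_pos.2 (hφ.pos (by linarith [hs.1]))).le

theorem integral_one_div_mono (hφ : ClassKInfty φ) {a b : ℝ} (ha : 1 ≤ a) (hab : a ≤ b) :
    ∫ s in (1 : ℝ)..a, 1 / φ s ≤ ∫ s in (1 : ℝ)..b, 1 / φ s := by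
  rw [← intervalIntegral.integral_add_adjacent_intervals
    (hφ.intervalIntegrable_one_div le_rfl ha) (hφ.intervalIntegrable_one_div ha (ha.trans hab))]
  linarith [hφ.integral_one_div_nonneg ha hab]

theorem integral_one_div_step (hφ : ClassKInfty φ) {a b m : ℝ} (ha : 1 ≤ a) (hb : 1 ≤ b)
    (hm : 0 ≤ m) (hab : b ≤ a + m * φ a) :
    ∫ s in (1 : ℝ)..b, 1 / φ s ≤ (∫ s in (1 : ℝ)..a, 1 / φ s) + m := by
  rcases le_total b a with h | h
  · linarith [hφ.integral_one_div_mono hb h]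
  · have hpos : 0 < φ a := hφ.pos (by linarith)
    have hle : ∫ s in a..b, 1 / φ s ≤ ∫ _ in a..b, 1 / φ a :=
      intervalIntegral.integral_mono_on h (hφ.intervalIntegrable_one_div ha hb)
        intervalIntegrable_const fun s hs =>
          one_div_le_one_div_of_le hpos (hφ.mono (by linarith) hs.1)
    have hconst : ∫ _ in a..b, 1 / φ a ≤ m := by
      rw [intervalIntegral.integral_const, smul_eq_mul, mul_one_div, div_le_iff₀ hpos]
      linarith
    rw [← intervalIntegral.integral_add_adjacent_intervals
      (hφ.intervalIntegrable_one_div le_rfl ha) (hφ.intervalIntegrable_one_div ha hb)]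
    linarith

/-- Discrete Bihari inequality. -/
theorem integral_one_div_le_add_sum (hφ : ClassKInfty φ) {w m : ℕ → ℝ} (hw : ∀ n, 1 ≤ w n)
    (hm : ∀ n, 0 ≤ m n) (hstep : ∀ n, w (n + 1) ≤ w n + m n * φ (w n)) (n : ℕ) :
    ∫ s in (1 : ℝ)..w n, 1 / φ s ≤
      (∫ s in (1 : ℝ)..w 0, 1 / φ s) + ∑ i ∈ Finset.range n, m i := by
  induction n with
  | zero => simp
  | succ n ih =>
    rw [Finset.sum_range_succ]
    linarith [hφ.integral_one_div_step (hw n) (hw (n + 1)) (hm n) (hstep n)]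

theorem exists_lt_integral_one_div (hφ : ClassKInfty φ)
    (hint : ∫⁻ s in Set.Ici (1 : ℝ), ENNReal.ofReal (1 / φ s) = ⊤) (C : ℝ) :
    ∃ M : ℝ, 1 ≤ M ∧ C < ∫ s in (1 : ℝ)..M, 1 / φ s := by
  by_contra! hC
  have hI : IntegrableOn (fun s => 1 / φ s) (Set.Ioi 1) := by
    refine integrableOn_Ioi_of_intervalIntegral_norm_bounded (l := atTop)
      (b := fun n : ℕ => (n : ℝ) + 1) C 1 (fun n => ?_)
      (tendsto_atTop_add_const_right _ _ tendsto_natCast_atTop_atTop)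
      (Eventually.of_forall fun n => ?_)
    · exact (intervalIntegrable_iff_integrableOn_Ioc_of_le (by simp)).1
        (hφ.intervalIntegrable_one_div le_rfl (by simp))
    · refine le_trans (le_of_eq ?_) (hC (n + 1) (by simp))
      refine intervalIntegral.integral_congr fun s hs => ?_
      rw [Set.uIcc_of_le (by simp)] at hs
      exact Real.norm_of_nonneg (one_div_pos.2 (hφ.pos (by linarith [hs.1]))).le
  have hlt := ((integrableOn_Ici_iff_integrableOn_Ioi).2 hI).lintegral_lt_top
  exact hlt.ne hint

end ClassKInfty

/-- Proposition 2: under the Lyapunov growth assumption on the `x`-subsystem and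
the summability condition on the solutions of the `z`-subsystem (with
`μ(s) = γ̃₁(s) + γ̃₂(s)/φ(1)`), the `x`-component of the cascade is UGB. -/
theorem stmt6 (nx nz : ℕ)
    (f : ℝ → ℕ → EuclideanSpace ℝ (Fin nx) → EuclideanSpace ℝ (Fin nz) →
      EuclideanSpace ℝ (Fin nx))
    (g : ℝ → ℕ → EuclideanSpace ℝ (Fin nz) → EuclideanSpace ℝ (Fin nz))
    (αt₁ αt₂ φ γt₁ γt₂ : ℝ → ℝ) (c Tstar : ℝ)
    (V : ℝ → ℕ → EuclideanSpace ℝ (Fin nx) → ℝ)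
    (hα₁ : ClassKInfty αt₁) (hα₂ : ClassKInfty αt₂) (hφ : ClassKInfty φ)
    (hγ₁ : ClassN γt₁) (hγ₂ : ClassN γt₂) (hc : 0 < c) (hT : 0 < Tstar)
    (hV : ∀ T : ℝ, 0 < T → T < Tstar → ∀ k : ℕ, ∀ x, ∀ z,
      (0 ≤ V T k x) ∧
      (αt₁ ‖x‖ ≤ V T k x ∧ V T k x ≤ αt₂ ‖x‖ + c) ∧
      (V T (k + 1) (f T k x z) - V T (k + 1) (f T k x 0) ≤
        T * γt₁ ‖z‖ * φ (V T k x) + T * γt₂ ‖z‖) ∧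
      (V T (k + 1) (f T k x 0) - V T k x ≤ 0))
    (hint : ∫⁻ s in Set.Ici (1 : ℝ), ENNReal.ofReal (1 / φ s) = ⊤)
    (ρ : ℝ → ℝ) (hρ : ClassKInfty ρ)
    (hsum : ∀ T : ℝ, 0 < T → T < Tstar → ∀ k₀ : ℕ,
      ∀ z : ℕ → EuclideanSpace ℝ (Fin nz),
        (∀ k, k₀ ≤ k → z (k + 1) = g T k (z k)) →
        Summable (fun j : ℕ => γt₁ ‖z (k₀ + j)‖ + γt₂ ‖z (k₀ + j)‖ / φ 1) ∧
        T * ∑' j : ℕ, (γt₁ ‖z (k₀ + j)‖ + γt₂ ‖z (k₀ + j)‖ / φ 1) ≤ ρ ‖z k₀‖) :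
    ∃ κ : ℝ → ℝ, ∃ c' Tt : ℝ, ClassKInfty κ ∧ 0 ≤ c' ∧ 0 < Tt ∧
      ∀ T : ℝ, 0 < T → T < Tt → ∀ k₀ : ℕ,
        ∀ x : ℕ → EuclideanSpace ℝ (Fin nx), ∀ z : ℕ → EuclideanSpace ℝ (Fin nz),
          (∀ k, k₀ ≤ k → x (k + 1) = f T k (x k) (z k)) →
          (∀ k, k₀ ≤ k → z (k + 1) = g T k (z k)) →
          ∀ k, k₀ ≤ k → ‖x k‖ ≤ κ (jnorm (x k₀) (z k₀)) + c' := by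
  have hnorm_le {a b : ℝ} : |a| ≤ √(a ^ 2 + b ^ 2) := Real.abs_le_sqrt (by nlinarith [sq_nonneg b])
  have hxle : ∀ (x : EuclideanSpace ℝ (Fin nx)) (z : EuclideanSpace ℝ (Fin nz)),
      ‖x‖ ≤ jnorm x z := fun x z => (le_abs_self _).trans hnorm_le
  have hzle : ∀ (x : EuclideanSpace ℝ (Fin nx)) (z : EuclideanSpace ℝ (Fin nz)),
      ‖z‖ ≤ jnorm x z := fun x z => by
    rw [jnorm, add_comm]
    exact (le_abs_self _).trans hnorm_le
  have hφ1 : 0 < φ 1 := hφ.pos one_pos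
  let S := {p : (ℝ × ℕ) × (ℕ → EuclideanSpace ℝ (Fin nx)) × (ℕ → EuclideanSpace ℝ (Fin nz)) × ℕ //
    (0 < p.1.1 ∧ p.1.1 < Tstar) ∧
    (∀ k, p.1.2 ≤ k → p.2.1 (k + 1) = f p.1.1 k (p.2.1 k) (p.2.2.1 k)) ∧
    (∀ k, p.1.2 ≤ k → p.2.2.1 (k + 1) = g p.1.1 k (p.2.2.1 k)) ∧ p.1.2 ≤ p.2.2.2}
  obtain ⟨κ, c', hκ, hc', hbound⟩ := exists_classKInfty_bound_of_nat (ι := S)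
    (p := fun p => jnorm (p.1.2.1 p.1.1.2) (p.1.2.2.1 p.1.1.2))
    (q := fun p => ‖p.1.2.1 p.1.2.2.2‖) (fun _ => Real.sqrt_nonneg _) (fun N => by
      set W : ℝ := αt₂ N + c + 1
      obtain ⟨M, hM1, hM⟩ := hφ.exists_lt_integral_one_div hint
        ((∫ s in (1 : ℝ)..W, 1 / φ s) + ρ N)
      obtain ⟨B, hB0, hB⟩ := hα₁.2 M
      refine ⟨B, ?_⟩
      rintro ⟨⟨⟨T, k₀⟩, x, z, k⟩, ⟨hT0, hTs⟩, hx, hz, hk⟩ hN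
      dsimp only at hT0 hTs hx hz hk hN ⊢
      obtain ⟨j, rfl⟩ := Nat.exists_eq_add_of_le hk
      set w : ℕ → ℝ := fun j => max (V T (k₀ + j) (x (k₀ + j))) 1
      set μ : ℕ → ℝ := fun j => γt₁ ‖z (k₀ + j)‖ + γt₂ ‖z (k₀ + j)‖ / φ 1
      have hw1 : ∀ j, 1 ≤ w j := fun j => le_max_right _ _
      have hμ : ∀ j, 0 ≤ μ j := fun j =>
        add_nonneg (hγ₁.2.2 _ (norm_nonneg _)) (div_nonneg (hγ₂.2.2 _ (norm_nonneg _)) hφ1.le)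
      have hstep : ∀ j, w (j + 1) ≤ w j + T * μ j * φ (w j) := fun j => by
        have hφw : φ 1 ≤ φ (w j) := hφ.mono zero_le_one (hw1 j)
        obtain ⟨hV0, -, hgrow, hdec⟩ := hV T hT0 hTs (k₀ + j) (x (k₀ + j)) (z (k₀ + j))
        rw [← hx _ (Nat.le_add_right _ _)] at hgrow
        have h₁ : T * γt₁ ‖z (k₀ + j)‖ * φ (V T (k₀ + j) (x (k₀ + j))) ≤
            T * γt₁ ‖z (k₀ + j)‖ * φ (w j) :=
          mul_le_mul_of_nonneg_left (hφ.mono hV0 (le_max_left _ _))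
            (mul_nonneg hT0.le (hγ₁.2.2 _ (norm_nonneg _)))
        have h₂ : T * γt₂ ‖z (k₀ + j)‖ ≤ T * (γt₂ ‖z (k₀ + j)‖ / φ 1) * φ (w j) := by
          calc T * γt₂ ‖z (k₀ + j)‖ = T * (γt₂ ‖z (k₀ + j)‖ / φ 1) * φ 1 := by field_simp
            _ ≤ _ := mul_le_mul_of_nonneg_left hφw
              (mul_nonneg hT0.le (div_nonneg (hγ₂.2.2 _ (norm_nonneg _)) hφ1.le))
        have hsplit : T * μ j * φ (w j) = T * γt₁ ‖z (k₀ + j)‖ * φ (w j) +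
            T * (γt₂ ‖z (k₀ + j)‖ / φ 1) * φ (w j) := by
          simp only [μ]; ring
        refine max_le ?_ ?_
        · have : V T (k₀ + j) (x (k₀ + j)) ≤ w j := le_max_left _ _
          rw [← add_assoc]
          linarith
        · have : 0 ≤ T * μ j * φ (w j) :=
            mul_nonneg (mul_nonneg hT0.le (hμ j)) (hφ1.le.trans hφw)
          linarith [hw1 j]
      have hbih := hφ.integral_one_div_le_add_sum hw1
        (fun j => mul_nonneg hT0.le (hμ j)) hstep j
      obtain ⟨hsm, htsum⟩ := hsum T hT0 hTs k₀ z hz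
      have hsumle : ∑ i ∈ Finset.range j, T * μ i ≤ ρ N := by
        rw [← Finset.mul_sum]
        calc T * ∑ i ∈ Finset.range j, μ i ≤ T * ∑' i, μ i :=
              mul_le_mul_of_nonneg_left (hsm.sum_le_tsum _ fun i _ => hμ i) hT0.le
          _ ≤ ρ ‖z k₀‖ := htsum
          _ ≤ ρ N := hρ.mono (norm_nonneg _) ((hzle _ _).trans hN)
      have hw0 : w 0 ≤ W := by
        have hV0 := (hV T hT0 hTs k₀ (x k₀) 0).2.1.2
        have hα := hα₂.mono (norm_nonneg (x k₀)) ((hxle _ _).trans hN)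
        have hαN : 0 ≤ αt₂ N := by
          simpa [hα₂.1.2.2] using hα₂.mono le_rfl (Nat.cast_nonneg N)
        refine max_le ?_ ?_
        · simp only [W, add_zero]; linarith
        · simp only [W]; linarith
      have hwM : w j < M := by
        by_contra! hle
        linarith [hφ.integral_one_div_mono hM1 hle, hφ.integral_one_div_mono (hw1 0) hw0]
      by_contra! hlt
      have hα := hα₁.mono hB0 hlt.le
      have hV1 := (hV T hT0 hTs (k₀ + j) (x (k₀ + j)) 0).2.1.1
      have : V T (k₀ + j) (x (k₀ + j)) ≤ w j := le_max_left _ _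
      linarith)
  exact ⟨κ, c', Tstar, hκ, hc', hT, fun T hT0 hTs k₀ x z hx hz k hk =>
    hbound ⟨((T, k₀), x, z, k), ⟨hT0, hTs⟩, hx, hz, hk⟩⟩
end

section
/- Consider the parameterized x-subsystem x(k+1)=f_T(k,x(k),z(k)) with input z. Suppose the solutions of the x-subsystem with input z are USC and the zero-input subsystem x(k+1)=f_T(k,x(k),0) is SP-UAS with KL function β_x. Then for any pair of strictly positive reals (Δ,ν) there exists T*>0 such that for any ε>0 and any η∈(0,Δ] there exists μ>0 such that for all input sequences with ‖ω^z‖<μ, all k₀≥0, all |x₀|≤η and all T∈(0,T*): |φ^x_T(k,k₀,x₀,ω^z)| ≤ max{β_x(|x₀|,(k−k₀)T), ν} + ε for all k≥k₀ (i.e., the bound of the finite-horizon lemma extends to the whole time axis). -/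
open Filter Topology

/-- A time-varying recursion can be started from any state at any time. -/
theorem exists_solution_from {E : Type*} (F : ℕ → E → E) (k₁ : ℕ) (a : E) :
    ∃ y : ℕ → E, y k₁ = a ∧ ∀ k, k₁ ≤ k → y (k + 1) = F k (y k) := by
  refine ⟨fun k => Nat.rec a (fun j v => F (k₁ + j) v) (k - k₁), by simp, fun k hk => ?_⟩
  obtain ⟨j, rfl⟩ := Nat.exists_eq_add_of_le hk
  simp [Nat.add_assoc]

/-- Every window of a sampled horizon `L` covers at least the time `L - T`. -/
theorem sub_le_floor_div_mul {L T : ℝ} (hT : 0 < T) :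
    L - T ≤ (⌊L / T⌋₊ : ℝ) * T := by
  have h := (div_lt_iff₀ hT).1 (Nat.lt_floor_add_one (L / T))
  linarith

/-- A class `KL` function is monotone in its first argument at positive times. -/
theorem ClassKL.mono_left_s8 {β : ℝ → ℝ → ℝ} (hβ : ClassKL β) {s r t : ℝ} (ht : 0 < t)
    (hs : 0 ≤ s) (hsr : s ≤ r) : β s t ≤ β r t :=
  (hβ.1 t ht).2.1.monotoneOn hs (hs.trans hsr) hsr

/-- A class `KL` function is antitone in its second argument. -/
theorem ClassKL.anti_right {β : ℝ → ℝ → ℝ} (hβ : ClassKL β) {s t u : ℝ} (hs : 0 < s)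
    (ht : 0 ≤ t) (htu : t ≤ u) : β s u ≤ β s t :=
  (hβ.2 s hs).1 ht (ht.trans htu) htu

/-- Lemma 2: under USC and SP-UAS of the zero-input subsystem with `KL` bound
`β_x`, the finite-horizon `ε`-bound extends to the whole time axis for inputs with sup norm
strictly below `μ`. -/
theorem stmt8 (nx nz : ℕ)
    (f : ℝ → ℕ → EuclideanSpace ℝ (Fin nx) → EuclideanSpace ℝ (Fin nz) →
      EuclideanSpace ℝ (Fin nx))
    (βx : ℝ → ℝ → ℝ) (husc : USC f) (hβx : ClassKL βx)
    (hspuas : ∀ Δ ν : ℝ, 0 < Δ → 0 < ν → ∃ Tstar : ℝ, 0 < Tstar ∧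
      ∀ T : ℝ, 0 < T → T < Tstar →
        ∀ k₀ : ℕ, ∀ x : ℕ → EuclideanSpace ℝ (Fin nx),
          (∀ k, k₀ ≤ k → x (k + 1) = f T k (x k) 0) → ‖x k₀‖ ≤ Δ →
          ∀ k, k₀ ≤ k → ‖x k‖ ≤ max (βx ‖x k₀‖ (((k - k₀ : ℕ) : ℝ) * T)) ν) :
    ∀ Δ ν : ℝ, 0 < Δ → 0 < ν → ∃ Tstar : ℝ, 0 < Tstar ∧
      ∀ ε : ℝ, 0 < ε → ∀ η : ℝ, 0 < η → η ≤ Δ → ∃ μ : ℝ, 0 < μ ∧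
        ∀ T : ℝ, 0 < T → T < Tstar →
          ∀ z : ℕ → EuclideanSpace ℝ (Fin nz), (∃ m : ℝ, m < μ ∧ ∀ k, ‖z k‖ ≤ m) →
            ∀ k₀ : ℕ, ∀ x : ℕ → EuclideanSpace ℝ (Fin nx),
              (∀ k, k₀ ≤ k → x (k + 1) = f T k (x k) (z k)) → ‖x k₀‖ ≤ η →
              ∀ k, k₀ ≤ k →
                ‖x k‖ ≤ max (βx ‖x k₀‖ (((k - k₀ : ℕ) : ℝ) * T)) ν + ε := by
  intro Δ ν hΔ hν
  obtain ⟨R, hR⟩ : ∃ R, R = max Δ (max (βx Δ 0) ν + 1) := ⟨_, rfl⟩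
  have hΔR : Δ ≤ R := hR ▸ le_max_left _ _
  have hβR : max (βx Δ 0) ν + 1 ≤ R := hR ▸ le_max_right _ _
  have hR0 : 0 < R := hΔ.trans_le hΔR
  obtain ⟨T₁, hT₁, hcont⟩ := husc (R + 1) (by linarith)
  obtain ⟨T₂, hT₂, hstab⟩ := hspuas R ν hR0 hν
  refine ⟨min 1 (min T₁ T₂), by positivity, fun ε hε η hη hηΔ => ?_⟩
  obtain ⟨τ, hτν, hτ⟩ : ∃ τ, βx R τ < ν ∧ 1 ≤ τ :=
    (((hβx.2 R hR0).2.eventually_lt_const hν).and (eventually_ge_atTop 1)).exists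
  obtain ⟨μ, hμ, hclose⟩ := hcont R (min ε 1) (τ + 1) hR0 (by linarith) (by positivity)
    (by linarith)
  refine ⟨μ, hμ, fun T hT hTmin z ⟨m, hm, hz⟩ k₀ x hx hx₀ => ?_⟩
  simp only [lt_min_iff] at hTmin
  obtain ⟨hT1, hTT₁, hTT₂⟩ := hTmin
  obtain ⟨ℓ, hℓ⟩ : ∃ ℓ, ℓ = ⌊(τ + 1) / T⌋₊ := ⟨_, rfl⟩
  have hℓτ : τ ≤ (ℓ : ℝ) * T := by
    have := sub_le_floor_div_mul (L := τ + 1) hT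
    rw [hℓ]
    linarith
  have hℓ0 : 0 < ℓ := by
    rcases Nat.eq_zero_or_pos ℓ with h | h
    · simp only [h, Nat.cast_zero, zero_mul] at hℓτ
      linarith
    · exact h
  have hβℓ : βx R ((ℓ : ℝ) * T) ≤ ν := (hβx.anti_right hR0 (by linarith) hℓτ).trans hτν.le
  have hwindow : ∀ k₁, k₀ ≤ k₁ → ‖x k₁‖ ≤ R → ∀ k, k₁ ≤ k → k ≤ k₁ + ℓ →
      ‖x k‖ ≤ max (βx ‖x k₁‖ (((k - k₁ : ℕ) : ℝ) * T)) ν + min ε 1 := by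
    intro k₁ hk₁ hxR k hk hkℓ
    obtain ⟨y, hy₁, hy⟩ := exists_solution_from (fun k v => f T k v 0) k₁ (x k₁)
    have hdiff := hclose T hT hTT₁ z (fun j => (hz j).trans hm.le) k₁ x y
      (fun j hj => hx j (hk₁.trans hj)) hy hy₁.symm hxR k hk (hℓ ▸ hkℓ)
    have hyk := hstab T hT hTT₂ k₁ y hy (hy₁ ▸ hxR) k hk
    rw [hy₁] at hyk
    linarith [norm_le_norm_add_norm_sub' (x k) (y k)]
  have hlate : ∀ k, k₀ + ℓ ≤ k → ‖x (k - ℓ)‖ ≤ R → ‖x k‖ ≤ ν + min ε 1 := by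
    intro k hk hkR
    have h := hwindow (k - ℓ) (by omega) hkR k (by omega) (by omega)
    rw [show k - (k - ℓ) = ℓ by omega] at h
    have hβ := hβx.mono_left_s8 (t := (ℓ : ℝ) * T) (by positivity) (norm_nonneg (x (k - ℓ))) hkR
    rwa [max_eq_right (hβ.trans hβℓ)] at h
  have hx₀Δ : ‖x k₀‖ ≤ Δ := hx₀.trans hηΔ
  have hbdd : ∀ k, k₀ ≤ k → ‖x k‖ ≤ R := by
    intro k
    induction k using Nat.strong_induction_on with
    | _ k ih =>
      intro hk
      rcases hk.eq_or_lt with rfl | hlt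
      · exact hx₀Δ.trans hΔR
      refine le_trans ?_ hβR
      rcases le_or_gt k (k₀ + ℓ) with hkℓ | hkℓ
      · have ht : 0 < ((k - k₀ : ℕ) : ℝ) * T :=
          mul_pos (Nat.cast_pos.2 (Nat.sub_pos_of_lt hlt)) hT
        refine (hwindow k₀ le_rfl (hx₀Δ.trans hΔR) k hk hkℓ).trans
          (add_le_add (max_le_max_right ν ?_) (min_le_right ε 1))
        exact (hβx.mono_left_s8 ht (norm_nonneg _) hx₀Δ).trans (hβx.anti_right hΔ le_rfl ht.le)
      · exact (hlate k hkℓ.le (ih (k - ℓ) (by omega) (by omega))).trans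
          (add_le_add (le_max_right _ _) (min_le_right ε 1))
  intro k hk
  rcases le_or_gt k (k₀ + ℓ) with hkℓ | hkℓ
  · exact (hwindow k₀ le_rfl (hbdd k₀ le_rfl) k hk hkℓ).trans
      (add_le_add le_rfl (min_le_left ε 1))
  · exact (hlate k hkℓ.le (hbdd (k - ℓ) (by omega))).trans
      (add_le_add (le_max_right _ _) (min_le_left ε 1))
end

section
/- Consider the double integrator ẋ₁=x₂, ẋ₂=u sampled with period T>0 and zero-order hold, whose exact discrete-time model is x₁(k+1)=x₁(k)+T·x₂(k)+0.5T²·u(k), x₂(k+1)=x₂(k)+T·u(k). With the controller u(k)=−(1/T)(x₁(k)+2x₂(k)), the closed-loop matrix is M_T = [[1−T/2, 0],[−1, −1]], which has −1 as an eigenvalue for every T>0; consequently, for every T>0 there exists a nonzero initial condition x₀∈ℝ² such that ‖M_T^k x₀‖ = ‖x₀‖ for all k∈ℕ, so the exact closed-loop system x(k+1)=M_T x(k) is not asymptotically stable for any T>0. -/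
theorem Matrix.pow_mulVec_of_mulVec_eq_smul {n R : Type*} [Fintype n] [DecidableEq n]
    [CommSemiring R] {M : Matrix n n R} {v : n → R} {c : R} (h : M.mulVec v = c • v) (k : ℕ) :
    (M ^ k).mulVec v = c ^ k • v := by
  induction k with
  | zero => simp
  | succ k ih => rw [pow_succ, ← Matrix.mulVec_mulVec, h, Matrix.mulVec_smul, ih, smul_smul,
      pow_succ']

theorem Matrix.norm_toEuclideanLin_pow_of_mulVec_eq_neg {n : Type*} [Fintype n] [DecidableEq n]
    {M : Matrix n n ℝ} {v : n → ℝ} (h : M.mulVec v = (-1 : ℝ) • v) (k : ℕ) :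
    ‖Matrix.toEuclideanLin (M ^ k) (WithLp.toLp 2 v)‖ = ‖WithLp.toLp 2 v‖ := by
  rw [Matrix.toLpLin_toLp, Matrix.toLin'_apply, Matrix.pow_mulVec_of_mulVec_eq_smul h,
    WithLp.toLp_smul, norm_smul]
  simp

/-- the exact discrete-time model of the sampled double integrator with the
Euler-based deadbeat controller `u = −(1/T)(x₁+2x₂)` has closed-loop matrix
`M_T = [[1−T/2, 0],[−1, −1]]`; for every `T>0` the number `−1` is an eigenvalue of `M_T`,
there is a nonzero initial condition whose iterates keep constant Euclidean norm, and
consequently the closed loop `x(k+1)=M_T x(k)` is not asymptotically stable. -/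
theorem stmt12 (T : ℝ) (hT : 0 < T) :
    (∃ v : Fin 2 → ℝ, v ≠ 0 ∧
      (!![1 - T / 2, 0; -1, -1] : Matrix (Fin 2) (Fin 2) ℝ).mulVec v = (-1 : ℝ) • v) ∧
    (∃ x₀ : EuclideanSpace ℝ (Fin 2), x₀ ≠ 0 ∧ ∀ k : ℕ,
      ‖Matrix.toEuclideanLin ((!![1 - T / 2, 0; -1, -1] : Matrix (Fin 2) (Fin 2) ℝ) ^ k) x₀‖
        = ‖x₀‖) ∧
    ¬ ∀ x₀ : EuclideanSpace ℝ (Fin 2),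
        Filter.Tendsto
          (fun k : ℕ =>
            Matrix.toEuclideanLin ((!![1 - T / 2, 0; -1, -1] : Matrix (Fin 2) (Fin 2) ℝ) ^ k) x₀)
          Filter.atTop (nhds 0) := by
  have hv : (!![1 - T / 2, 0; -1, -1] : Matrix (Fin 2) (Fin 2) ℝ).mulVec ![0, 1]
      = (-1 : ℝ) • ![0, 1] := by
    ext i
    fin_cases i <;> simp [Matrix.mulVec, dotProduct]
  have hv0 : (![0, 1] : Fin 2 → ℝ) ≠ 0 := fun h => by simpa using congrFun h 1
  have hx0 : (WithLp.toLp 2 ![0, 1] : EuclideanSpace ℝ (Fin 2)) ≠ 0 := by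
    simp
  have hnorm := Matrix.norm_toEuclideanLin_pow_of_mulVec_eq_neg hv
  refine ⟨⟨_, hv0, hv⟩, ⟨_, hx0, hnorm⟩, fun h => hx0 ?_⟩
  have hlim := (h (WithLp.toLp 2 ![0, 1])).norm
  simp only [hnorm, norm_zero] at hlim
  exact norm_eq_zero.mp (tendsto_nhds_unique tendsto_const_nhds hlim)
end

section
/- Consider the Euler approximate model of the double integrator: x₁(k+1)=x₁(k)+T·x₂(k), x₂(k+1)=x₂(k)+T·u(k), with controller u(k)=−(1/T)(x₁(k)+2x₂(k)), giving the closed-loop matrix N_T = [[1, T],[−1, −1]]. Then for every T∈(0,1) the eigenvalues of N_T are ±√(1−T), and there exists b>0 such that for all T∈(0,0.5), all x₀∈ℝ² and all k∈ℕ: ‖N_T^k x₀‖ ≤ b·‖x₀‖·e^{−0.5kT}. -/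
/-- The square of the closed-loop matrix is the scalar matrix `1 - T`. -/
theorem closedLoop_sq (T : ℝ) :
    (!![1, T; -1, -1] : Matrix (Fin 2) (Fin 2) ℝ) ^ 2 = (1 - T) • 1 := by
  ext i j
  fin_cases i <;> fin_cases j <;>
    simp [pow_two, Matrix.mul_apply, Fin.sum_univ_two] <;> ring

theorem closedLoop_pow_even (T : ℝ) (m : ℕ) :
    (!![1, T; -1, -1] : Matrix (Fin 2) (Fin 2) ℝ) ^ (2 * m) = (1 - T) ^ m • 1 := by
  rw [pow_mul, closedLoop_sq, smul_pow, one_pow]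

theorem norm_closedLoop_le {T : ℝ} (hT0 : 0 ≤ T) (hT1 : T ≤ 1) (x : EuclideanSpace ℝ (Fin 2)) :
    ‖Matrix.toEuclideanLin (!![1, T; -1, -1] : Matrix (Fin 2) (Fin 2) ℝ) x‖ ≤ 2 * ‖x‖ := by
  refine le_of_sq_le_sq ?_ (by positivity)
  rw [mul_pow, EuclideanSpace.real_norm_sq_eq, EuclideanSpace.real_norm_sq_eq]
  simp only [Matrix.toLpLin_apply, Fin.sum_univ_two, Matrix.mulVec, dotProduct,
    Matrix.of_apply, Matrix.cons_val_zero, Matrix.cons_val_one]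
  have hT2 : T ^ 2 ≤ 1 := pow_le_one₀ hT0 hT1
  nlinarith [sq_nonneg (x 0 - T * x 1), sq_nonneg (x 0 - x 1),
    mul_nonneg (sub_nonneg.2 hT2) (sq_nonneg (x 1))]


/-- the Euler model of the double integrator with controller
`u = −(1/T)(x₁+2x₂)` has closed-loop matrix `N_T = [[1, T],[−1, −1]]`; for every `T∈(0,1)`
its eigenvalues are exactly `±√(1−T)`, and there is a uniform `b>0` such that for all
`T∈(0,0.5)` the iterates satisfy `‖N_T^k x₀‖ ≤ b‖x₀‖e^{−0.5kT}`. -/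
theorem stmt13 :
    (∀ T : ℝ, 0 < T → T < 1 → ∀ lam : ℝ,
      ((∃ v : Fin 2 → ℝ, v ≠ 0 ∧
          (!![1, T; -1, -1] : Matrix (Fin 2) (Fin 2) ℝ).mulVec v = lam • v) ↔
        (lam = Real.sqrt (1 - T) ∨ lam = -Real.sqrt (1 - T)))) ∧
    ∃ b : ℝ, 0 < b ∧ ∀ T : ℝ, 0 < T → T < 0.5 →
      ∀ x₀ : EuclideanSpace ℝ (Fin 2), ∀ k : ℕ,
        ‖Matrix.toEuclideanLin ((!![1, T; -1, -1] : Matrix (Fin 2) (Fin 2) ℝ) ^ k) x₀‖ ≤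
          b * ‖x₀‖ * Real.exp (-0.5 * k * T) := by
  refine ⟨fun T hT0 hT1 lam => ?_, 4, by norm_num, fun T hT0 hT1 x k => ?_⟩
  · have hsq : lam = √(1 - T) ∨ lam = -√(1 - T) ↔ lam ^ 2 = 1 - T := by
      rw [← sq_eq_sq_iff_eq_or_eq_neg, Real.sq_sqrt (by linarith)]
    rw [hsq]
    constructor
    · rintro ⟨v, hv, h⟩
      have h2 : (lam ^ 2 - (1 - T)) • v = 0 := by
        have h' := congrArg (Matrix.mulVec !![1, T; -1, -1]) h
        rw [Matrix.mulVec_mulVec, ← pow_two, closedLoop_sq, Matrix.mulVec_smul, h,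
          Matrix.smul_mulVec, Matrix.one_mulVec, smul_smul, ← pow_two] at h'
        rw [sub_smul, h', sub_self]
      exact sub_eq_zero.1 ((smul_eq_zero.1 h2).resolve_right hv)
    · intro h
      refine ⟨![T, lam - 1], fun h0 => hT0.ne' (congrFun h0 0), ?_⟩
      ext i
      fin_cases i <;> simp [Matrix.mulVec, dotProduct, Fin.sum_univ_two] <;> linarith
  · norm_num at hT1
    have hpow (m : ℕ) : (1 - T) ^ m ≤ Real.exp (-(m * T)) := by
      rw [← mul_neg, Real.exp_nat_mul]
      exact pow_le_pow_left₀ (by linarith) (Real.one_sub_le_exp_neg T) m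
    have hnn (m : ℕ) : 0 ≤ (1 - T) ^ m := pow_nonneg (by linarith) m
    obtain ⟨m, rfl | rfl⟩ := Nat.even_or_odd' k
    · rw [closedLoop_pow_even, map_smul, Matrix.toLpLin_one, LinearMap.smul_apply,
        LinearMap.id_apply, norm_smul, Real.norm_of_nonneg (hnn m)]
      have he : -0.5 * ((2 * m : ℕ) : ℝ) * T = -(m * T) := by push_cast; ring
      rw [he]
      nlinarith [mul_le_mul_of_nonneg_right (hpow m) (norm_nonneg x),
        mul_nonneg (norm_nonneg x) (Real.exp_pos (-(m * T))).le]
    · rw [pow_succ, closedLoop_pow_even, smul_mul_assoc, one_mul, map_smul,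
        LinearMap.smul_apply, norm_smul, Real.norm_of_nonneg (hnn m)]
      have he : -0.5 * ((2 * m + 1 : ℕ) : ℝ) * T = -(m * T) + -(T / 2) := by push_cast; ring
      rw [he, Real.exp_add]
      have hhalf : 1 / 2 ≤ Real.exp (-(T / 2)) := by
        linarith [Real.one_sub_le_exp_neg (T / 2)]
      calc _ ≤ Real.exp (-(m * T)) * (2 * ‖x‖) :=
            mul_le_mul (hpow m) (norm_closedLoop_le hT0.le (by linarith) x) (norm_nonneg _)
              (Real.exp_pos _).le
        _ = 4 * ‖x‖ * (Real.exp (-(m * T)) * (1 / 2)) := by ring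
        _ ≤ _ := by gcongr
end

section
/- Consider the Euler closed-loop model of the unicycle tracking problem on ℝ³ with state (x_e,y_e,θ_e) and parameter T>0: x_e(k+1) = (1−T·a₂)x_e(k) + T·ω_r(k)·y_e(k) − T²·ϑ(k,x_e(k),y_e(k)) + T[a₁·θ_e(k)·y_e(k) − v_r(k) + v_r(k)·cos θ_e(k)]; y_e(k+1) = y_e(k) − T·ω_r(k)·x_e(k) + T[−a₁·θ_e(k)·x_e(k) + v_r(k)·sin θ_e(k)]; θ_e(k+1) = (1−T·a₁)·θ_e(k). Assume: (1) there exist T̂,w_M>0 such that for all k≥0 and all T∈(0,T̂): max{|v_r(k)|, |ω_r(k)|, |ω_r(k)−ω_r(k−1)|/T} ≤ w_M; and (2) ω_r is persistently exciting. Then there exists a₂>0 such that for all K,a₁>0 and all functions ϑ with |ϑ(k,x)| ≤ K|x|, the closed-loop family of systems is UGAS. -/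
open Filter Topology

/-- The bounded solution of `S k = T * ω k ^ 2 + S (k + 1) / (1 + T)`, an exponentially discounted
sum of the future excitation, is bounded below under persistency of excitation. -/
theorem exists_discounted_excitation {ω : ℕ → ℝ} {T L μ w : ℝ} {N : ℕ} (hT : 0 < T) (hT1 : T ≤ 1)
    (hω : ∀ k, |ω k| ≤ w) (hN : N * T ≤ L)
    (hPE : ∀ j, μ ≤ T * ∑ k ∈ Finset.Icc j (j + N), ω k ^ 2) :
    ∃ S : ℕ → ℝ, ∀ k, Real.exp (-L) * μ ≤ S k ∧ S k ≤ 2 * w ^ 2 ∧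
      S k = T * ω k ^ 2 + S (k + 1) / (1 + T) := by
  set q : ℝ := 1 / (1 + T) with hq
  have hq0 : 0 < q := by positivity
  have hq1 : q < 1 := by rw [hq, div_lt_one (by positivity)]; linarith
  have hw2 : ∀ k, ω k ^ 2 ≤ w ^ 2 := fun k => sq_le_sq' (abs_le.mp (hω k)).1 (abs_le.mp (hω k)).2
  have hgeo : Summable fun i : ℕ => q ^ i * w ^ 2 :=
    (summable_geometric_of_lt_one hq0.le hq1).mul_right _
  have hnn : ∀ k i : ℕ, 0 ≤ q ^ i * ω (k + i) ^ 2 := fun k i => by positivity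
  have hle : ∀ k i : ℕ, q ^ i * ω (k + i) ^ 2 ≤ q ^ i * w ^ 2 := fun k i =>
    mul_le_mul_of_nonneg_left (hw2 _) (by positivity)
  have hsum : ∀ k, Summable fun i : ℕ => q ^ i * ω (k + i) ^ 2 := fun k =>
    Summable.of_nonneg_of_le (hnn k) (hle k) hgeo
  refine ⟨fun k => T * ∑' i : ℕ, q ^ i * ω (k + i) ^ 2, fun k => ⟨?_, ?_, ?_⟩⟩
  · have hqN : Real.exp (-L) ≤ q ^ N := by
      have h1 : (1 + T) ^ N ≤ Real.exp L := by
        calc (1 + T) ^ N ≤ Real.exp T ^ N := by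
              gcongr
              linarith [Real.add_one_le_exp T]
          _ = Real.exp (N * T) := by rw [← Real.exp_nat_mul]
          _ ≤ Real.exp L := Real.exp_le_exp.mpr hN
      rw [Real.exp_neg, hq, one_div, inv_pow]
      gcongr
    have hfin : ∑ i ∈ Finset.range (N + 1), q ^ i * ω (k + i) ^ 2 ≤
        ∑' i : ℕ, q ^ i * ω (k + i) ^ 2 :=
      (hsum k).sum_le_tsum _ fun i _ => hnn k i
    have hIcc : ∑ j ∈ Finset.Icc k (k + N), ω j ^ 2 =
        ∑ i ∈ Finset.range (N + 1), ω (k + i) ^ 2 := by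
      rw [← Finset.Ico_add_one_right_eq_Icc, Finset.sum_Ico_eq_sum_range]
      congr 2
      omega
    have hweight : q ^ N * ∑ i ∈ Finset.range (N + 1), ω (k + i) ^ 2 ≤
        ∑ i ∈ Finset.range (N + 1), q ^ i * ω (k + i) ^ 2 := by
      rw [Finset.mul_sum]
      refine Finset.sum_le_sum fun i hi => ?_
      have : q ^ N ≤ q ^ i := pow_le_pow_of_le_one hq0.le hq1.le (by
        have := Finset.mem_range.mp hi; omega)
      gcongr
    have hP := hPE k
    rw [hIcc] at hP
    calc Real.exp (-L) * μ
        ≤ Real.exp (-L) * (T * ∑ i ∈ Finset.range (N + 1), ω (k + i) ^ 2) :=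
          mul_le_mul_of_nonneg_left hP (Real.exp_pos _).le
      _ ≤ q ^ N * (T * ∑ i ∈ Finset.range (N + 1), ω (k + i) ^ 2) := by
          have : 0 ≤ T * ∑ i ∈ Finset.range (N + 1), ω (k + i) ^ 2 :=
            mul_nonneg hT.le (Finset.sum_nonneg fun i _ => sq_nonneg _)
          gcongr
      _ = T * (q ^ N * ∑ i ∈ Finset.range (N + 1), ω (k + i) ^ 2) := by ring
      _ ≤ _ := mul_le_mul_of_nonneg_left (hweight.trans hfin) hT.le
  · have h1 : ∑' i : ℕ, q ^ i * ω (k + i) ^ 2 ≤ ∑' i : ℕ, q ^ i * w ^ 2 :=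
      (hsum k).tsum_le_tsum (hle k) hgeo
    rw [tsum_mul_right, tsum_geometric_of_lt_one hq0.le hq1] at h1
    have h2 : T * ((1 - q)⁻¹ * w ^ 2) = (1 + T) * w ^ 2 := by
      have : 1 - q = T / (1 + T) := by rw [hq]; field_simp; ring
      rw [this]
      field_simp
    calc T * ∑' i : ℕ, q ^ i * ω (k + i) ^ 2 ≤ T * ((1 - q)⁻¹ * w ^ 2) := by gcongr
      _ = (1 + T) * w ^ 2 := h2
      _ ≤ 2 * w ^ 2 := by gcongr; linarith
  · have h := (hsum k).tsum_eq_zero_add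
    have hshift : ∑' i : ℕ, q ^ (i + 1) * ω (k + (i + 1)) ^ 2 =
        q * ∑' i : ℕ, q ^ i * ω (k + 1 + i) ^ 2 := by
      rw [← tsum_mul_left]
      refine tsum_congr fun i => ?_
      rw [show k + (i + 1) = k + 1 + i by ring]
      ring
    simp only [pow_zero, add_zero, one_mul] at h
    beta_reduce
    rw [h, hshift, hq]
    ring

/-- The quadratic Lyapunov function candidate for the linear position error dynamics. -/
noncomputable def trackV (γ ω S x y : ℝ) : ℝ :=
  γ * (x ^ 2 + y ^ 2) - ω * x * y - S * y ^ 2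

theorem abs_mul_le_half_sq_add_sq (x y : ℝ) : |x * y| ≤ (x ^ 2 + y ^ 2) / 2 := by
  rw [abs_le]
  constructor <;> nlinarith [sq_nonneg (x - y), sq_nonneg (x + y)]

theorem mul_mul_le_of_abs_le {a w x y : ℝ} (ha : |a| ≤ w) :
    a * (x * y) ≤ w * ((x ^ 2 + y ^ 2) / 2) :=
  calc a * (x * y) ≤ |a * (x * y)| := le_abs_self _
    _ = |a| * |x * y| := abs_mul _ _
    _ ≤ _ := mul_le_mul ha (abs_mul_le_half_sq_add_sq x y) (abs_nonneg _) ((abs_nonneg _).trans ha)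

theorem le_trackV {γ ω S w x y : ℝ} (hω : |ω| ≤ w) (hS : S ≤ 2 * w ^ 2)
    (hγ : 1 + w + 2 * w ^ 2 ≤ γ) : x ^ 2 + y ^ 2 ≤ trackV γ ω S x y := by
  have hw : 0 ≤ w := (abs_nonneg _).trans hω
  have h1 := mul_mul_le_of_abs_le (x := x) (y := y) hω
  have h2 : S * y ^ 2 ≤ 2 * w ^ 2 * (x ^ 2 + y ^ 2) := by
    nlinarith [sq_nonneg x, sq_nonneg y, mul_nonneg (sq_nonneg w) (sq_nonneg x),
      mul_le_mul_of_nonneg_right hS (sq_nonneg y)]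
  have h3 := mul_le_mul_of_nonneg_right hγ (add_nonneg (sq_nonneg x) (sq_nonneg y))
  have h4 : 0 ≤ w * (x ^ 2 + y ^ 2) := by positivity
  unfold trackV
  linarith

theorem trackV_le {γ ω S w x y : ℝ} (hω : |ω| ≤ w) (hS : 0 ≤ S) :
    trackV γ ω S x y ≤ (γ + w) * (x ^ 2 + y ^ 2) := by
  have hw : 0 ≤ w := (abs_nonneg _).trans hω
  have h1 := mul_mul_le_of_abs_le (a := -ω) (w := w) (x := x) (y := y) (by rwa [abs_neg])
  have h2 : 0 ≤ S * y ^ 2 := by positivity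
  have h4 : 0 ≤ w * (x ^ 2 + y ^ 2) := by positivity
  unfold trackV
  linarith

theorem abs_add_mul_le_sqrt_mul_sqrt (a b c d : ℝ) :
    |a * c + b * d| ≤ Real.sqrt (a ^ 2 + b ^ 2) * Real.sqrt (c ^ 2 + d ^ 2) := by
  rw [← Real.sqrt_mul (by positivity)]
  apply Real.abs_le_sqrt
  nlinarith [sq_nonneg (a * d - b * c)]

/-- `√V` is subadditive up to a constant. -/
theorem sqrt_trackV_add_le {γ ω S w x y p q : ℝ} (hω : |ω| ≤ w) (hS0 : 0 ≤ S)
    (hS : S ≤ 2 * w ^ 2) (hγ : 1 + w + 2 * w ^ 2 ≤ γ) :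
    Real.sqrt (trackV γ ω S (x + p) (y + q)) ≤
      Real.sqrt (trackV γ ω S x y) + (γ + w + 2 * w ^ 2) * Real.sqrt (p ^ 2 + q ^ 2) := by
  have hw : 0 ≤ w := (abs_nonneg _).trans hω
  set r := Real.sqrt (x ^ 2 + y ^ 2) with hr
  set m := Real.sqrt (p ^ 2 + q ^ 2) with hm
  set W := Real.sqrt (trackV γ ω S x y) with hW
  have hV : x ^ 2 + y ^ 2 ≤ trackV γ ω S x y := le_trackV hω hS hγ
  have hrW : r ≤ W := Real.sqrt_le_sqrt hV
  have hW2 : W ^ 2 = trackV γ ω S x y :=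
    Real.sq_sqrt ((by positivity : 0 ≤ x ^ 2 + y ^ 2).trans hV)
  have hm2 : m ^ 2 = p ^ 2 + q ^ 2 := Real.sq_sqrt (by positivity)
  have hr0 : 0 ≤ r := Real.sqrt_nonneg _
  have hm0 : 0 ≤ m := Real.sqrt_nonneg _
  have hW0 : 0 ≤ W := Real.sqrt_nonneg _
  have hγ0 : 1 ≤ γ := by nlinarith
  have hpq : trackV γ ω S p q ≤ (γ + w) * m ^ 2 := hm2 ▸ trackV_le hω hS0
  have e1 : γ * (x * p + y * q) ≤ γ * (r * m) :=
    mul_le_mul_of_nonneg_left ((le_abs_self _).trans (abs_add_mul_le_sqrt_mul_sqrt x y p q))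
      (by linarith)
  have e2 : -ω * (x * q + y * p) ≤ w * (r * m) := by
    have h := abs_add_mul_le_sqrt_mul_sqrt x y q p
    rw [add_comm (q ^ 2)] at h
    calc -ω * (x * q + y * p) ≤ |(-ω) * (x * q + y * p)| := le_abs_self _
      _ = |ω| * |x * q + y * p| := by rw [abs_mul, abs_neg]
      _ ≤ w * (r * m) := mul_le_mul hω h (abs_nonneg _) hw
  have e3 : S * -(y * q) ≤ 2 * w ^ 2 * (r * m) := by
    have hy : |y| ≤ r := Real.abs_le_sqrt (by nlinarith [sq_nonneg x])
    have hq : |q| ≤ m := Real.abs_le_sqrt (by nlinarith [sq_nonneg p])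
    have : -(y * q) ≤ r * m := by
      calc -(y * q) ≤ |y * q| := neg_le_abs _
        _ = |y| * |q| := abs_mul _ _
        _ ≤ r * m := mul_le_mul hy hq (abs_nonneg _) hr0
    calc S * -(y * q) ≤ S * (r * m) := mul_le_mul_of_nonneg_left this hS0
      _ ≤ _ := mul_le_mul_of_nonneg_right hS (by positivity)
  set Γ := γ + w + 2 * w ^ 2 with hΓ
  have hΓ1 : 1 ≤ Γ := by nlinarith [sq_nonneg w]
  have hexp : trackV γ ω S (x + p) (y + q) = trackV γ ω S x y + trackV γ ω S p q
      + (2 * (γ * (x * p + y * q)) + -ω * (x * q + y * p) + 2 * (S * -(y * q))) := by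
    unfold trackV
    ring
  have hrm : r * m ≤ W * m := mul_le_mul_of_nonneg_right hrW hm0
  have hcross : 2 * (γ * (x * p + y * q)) + -ω * (x * q + y * p) + 2 * (S * -(y * q)) ≤
      2 * (Γ * (W * m)) := by
    have h1 : Γ * (r * m) ≤ Γ * (W * m) := mul_le_mul_of_nonneg_left hrm (by linarith)
    have h2 : 0 ≤ w * (r * m) := by positivity
    rw [hΓ] at h1 ⊢
    linarith
  apply Real.sqrt_le_iff.mpr
  refine ⟨by positivity, ?_⟩
  have h5 : (γ + w) * m ^ 2 ≤ Γ ^ 2 * m ^ 2 := by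
    apply mul_le_mul_of_nonneg_right _ (sq_nonneg m)
    nlinarith [sq_nonneg w]
  rw [hexp, ← hW2]
  nlinarith

/-- Strict decrease of the Lyapunov function along the linear dynamics with damping gain one. -/
theorem trackV_step_le {γ ω ω' S S' T w s x y : ℝ} (hT : 0 < T) (hT1 : T ≤ 1) (hs : 0 < s)
    (hω : |ω| ≤ w) (hω' : |ω'| ≤ w) (hd : |ω' - ω| ≤ T * w) (hsS : s ≤ S')
    (hS' : S' ≤ 2 * w ^ 2) (hS : S = T * ω ^ 2 + S' / (1 + T)) (hγ0 : 0 ≤ γ)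
    (hγ : w ^ 2 + (2 * w + 4 * w ^ 3) ^ 2 / s + s ≤ 2 * γ)
    (hTR : T * (γ * (1 + w + w ^ 2) + w ^ 2 + w ^ 3) ≤ s / 8) :
    trackV γ ω' S' ((1 - T) * x + T * ω * y) (y - T * ω * x) ≤
      trackV γ ω S x y - T * (s / 8) * (x ^ 2 + y ^ 2) := by
  have hw : 0 ≤ w := (abs_nonneg _).trans hω
  have hx2 := sq_nonneg x
  have hy2 := sq_nonneg y
  have hω2 : ω ^ 2 ≤ w ^ 2 := sq_le_sq' (abs_le.mp hω).1 (abs_le.mp hω).2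
  have hexp : trackV γ ω' S' ((1 - T) * x + T * ω * y) (y - T * ω * x) - trackV γ ω S x y =
      -(2 * γ * T * x ^ 2) + T ^ 2 * (γ * (x ^ 2 * (1 + ω ^ 2) + -(2 * ω) * (x * y) + ω ^ 2 * y ^ 2))
      + ((ω - ω') + ω' * T + 2 * T * ω * S') * (x * y) + T * (1 - T) * (ω' * ω) * x ^ 2
      + T * (ω * (ω - ω')) * y ^ 2 + T ^ 2 * (ω' * ω ^ 2) * (x * y)
      + (S - S' - T * ω ^ 2) * y ^ 2 - T ^ 2 * ω ^ 2 * S' * x ^ 2 := by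
    unfold trackV
    ring
  have b1 : T ^ 2 * (γ * (x ^ 2 * (1 + ω ^ 2) + -(2 * ω) * (x * y) + ω ^ 2 * y ^ 2)) ≤
      T ^ 2 * (γ * ((1 + w + w ^ 2) * (x ^ 2 + y ^ 2))) := by
    gcongr
    have h1 := mul_mul_le_of_abs_le (a := -(2 * ω)) (w := 2 * w) (x := x) (y := y) (by
      rw [abs_neg, abs_mul, abs_two]; linarith)
    nlinarith [mul_le_mul_of_nonneg_right hω2 hx2, mul_le_mul_of_nonneg_right hω2 hy2]
  have hωω' : |ω' * ω| ≤ w ^ 2 := by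
    rw [abs_mul, sq]; exact mul_le_mul hω' hω (abs_nonneg _) hw
  have b2 : ((ω - ω') + ω' * T + 2 * T * ω * S') * (x * y) ≤
      T * (s / 4 * y ^ 2 + (2 * w + 4 * w ^ 3) ^ 2 / s * x ^ 2) := by
    have hS'0 : 0 ≤ S' := by linarith
    have h1 : |(ω - ω') + ω' * T + 2 * T * ω * S'| ≤ T * (2 * w + 4 * w ^ 3) := by
      have t1 : |ω - ω'| ≤ T * w := by rwa [abs_sub_comm]
      have t2 : |ω' * T| ≤ w * T := by
        rw [abs_mul, abs_of_pos hT]; gcongr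
      have t3 : |2 * T * ω * S'| ≤ 2 * T * w * (2 * w ^ 2) := by
        rw [abs_mul, abs_mul, abs_of_nonneg hS'0, abs_of_pos (by positivity : 0 < 2 * T)]
        gcongr
      calc _ ≤ |ω - ω'| + |ω' * T| + |2 * T * ω * S'| := abs_add_three _ _ _
        _ ≤ _ := by linarith
    have h2 : ((ω - ω') + ω' * T + 2 * T * ω * S') * (x * y) ≤
        T * (2 * w + 4 * w ^ 3) * |x * y| := by
      calc _ ≤ |((ω - ω') + ω' * T + 2 * T * ω * S') * (x * y)| := le_abs_self _
        _ = |(ω - ω') + ω' * T + 2 * T * ω * S'| * |x * y| := abs_mul _ _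
        _ ≤ _ := by gcongr
    have h3 : (2 * w + 4 * w ^ 3) * |x * y| ≤
        s / 4 * y ^ 2 + (2 * w + 4 * w ^ 3) ^ 2 / s * x ^ 2 := by
      rw [abs_mul, ← sq_abs x, ← sq_abs y]
      have : s / 4 * |y| ^ 2 + (2 * w + 4 * w ^ 3) ^ 2 / s * |x| ^ 2
          - (2 * w + 4 * w ^ 3) * (|x| * |y|) =
          (s * |y| / 2 - (2 * w + 4 * w ^ 3) * |x|) ^ 2 / s := by
        field_simp
        ring
      have h : 0 ≤ (s * |y| / 2 - (2 * w + 4 * w ^ 3) * |x|) ^ 2 / s := by positivity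
      linarith
    calc _ ≤ _ := h2
      _ = T * ((2 * w + 4 * w ^ 3) * |x * y|) := by ring
      _ ≤ _ := by gcongr
  have b3 : T * (1 - T) * (ω' * ω) * x ^ 2 ≤ T * w ^ 2 * x ^ 2 := by
    have h1 : (1 - T) * (ω' * ω) ≤ w ^ 2 :=
      calc (1 - T) * (ω' * ω) ≤ (1 - T) * w ^ 2 :=
            mul_le_mul_of_nonneg_left ((le_abs_self _).trans hωω') (by linarith)
        _ ≤ w ^ 2 := by nlinarith [mul_nonneg hT.le (sq_nonneg w)]
    calc T * (1 - T) * (ω' * ω) * x ^ 2 = T * ((1 - T) * (ω' * ω)) * x ^ 2 := by ring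
      _ ≤ _ := by gcongr
  have b4 : T * (ω * (ω - ω')) * y ^ 2 ≤ T ^ 2 * w ^ 2 * (x ^ 2 + y ^ 2) := by
    have h1 : ω * (ω - ω') ≤ w * (T * w) :=
      calc ω * (ω - ω') ≤ |ω * (ω - ω')| := le_abs_self _
        _ = |ω| * |ω' - ω| := by rw [abs_mul, abs_sub_comm ω]
        _ ≤ _ := mul_le_mul hω hd (abs_nonneg _) hw
    calc T * (ω * (ω - ω')) * y ^ 2 ≤ T * (w * (T * w)) * y ^ 2 := by gcongr
      _ = T ^ 2 * w ^ 2 * y ^ 2 := by ring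
      _ ≤ _ := by gcongr; linarith
  have b5 : T ^ 2 * (ω' * ω ^ 2) * (x * y) ≤ T ^ 2 * w ^ 3 * (x ^ 2 + y ^ 2) := by
    have h1 : |ω' * ω ^ 2| ≤ w ^ 3 := by
      rw [abs_mul, abs_of_nonneg (sq_nonneg ω)]
      calc |ω'| * ω ^ 2 ≤ w * w ^ 2 := by gcongr
        _ = w ^ 3 := by ring
    have h2 := mul_mul_le_of_abs_le (x := x) (y := y) h1
    have h3 : 0 ≤ w ^ 3 * (x ^ 2 + y ^ 2) := by positivity
    calc T ^ 2 * (ω' * ω ^ 2) * (x * y) = T ^ 2 * ((ω' * ω ^ 2) * (x * y)) := by ring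
      _ ≤ T ^ 2 * (w ^ 3 * (x ^ 2 + y ^ 2)) :=
          mul_le_mul_of_nonneg_left (by linarith) (sq_nonneg T)
      _ = _ := by ring
  have b6 : (S - S' - T * ω ^ 2) * y ^ 2 ≤ -(T * (s / 2)) * y ^ 2 := by
    gcongr
    have h1 : S - S' - T * ω ^ 2 = -(T * (S' / (1 + T))) := by
      rw [hS]; field_simp; ring
    have h2 : s / 2 ≤ S' / (1 + T) := by
      rw [le_div_iff₀ (by positivity)]
      nlinarith
    rw [h1]
    have := mul_le_mul_of_nonneg_left h2 hT.le
    linarith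
  have b7 : 0 ≤ T ^ 2 * ω ^ 2 * S' * x ^ 2 := by
    have : 0 ≤ S' := by linarith
    positivity
  have c1 := mul_le_mul_of_nonneg_right hγ (mul_nonneg hT.le hx2)
  have c2 := mul_le_mul_of_nonneg_right hTR (mul_nonneg hT.le (add_nonneg hx2 hy2))
  have c3 := mul_nonneg (mul_nonneg hT.le hs.le) hx2
  have c4 := mul_nonneg (mul_nonneg hT.le hs.le) hy2
  linarith

theorem abs_cos_sub_one_le (t : ℝ) : |Real.cos t - 1| ≤ |t| := by
  rw [abs_of_nonpos (by linarith [Real.cos_le_one t])]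
  have h1 := Real.one_sub_sq_div_two_le_cos (x := t)
  have h2 := Real.neg_one_le_cos t
  rw [← sq_abs] at h1
  rcases le_total |t| 2 with h | h
  · nlinarith [abs_nonneg t]
  · linarith

/-- Bound on the deviation of the closed loop from its linear part. -/
theorem sqrt_tracking_perturbation_le {T K a w v f t x y : ℝ} (hT : 0 < T) (ha : 0 < a)
    (hv : |v| ≤ w) (hf : |f| ≤ K * Real.sqrt (x ^ 2 + y ^ 2)) :
    Real.sqrt ((-(T ^ 2 * f) + T * (a * t * y + v * (Real.cos t - 1))) ^ 2 +
      (T * (-(a * t * x) + v * Real.sin t)) ^ 2) ≤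
      (T ^ 2 * K + 2 * (T * a * |t|)) * Real.sqrt (x ^ 2 + y ^ 2) + 2 * (T * w * |t|) := by
  have hw : 0 ≤ w := (abs_nonneg _).trans hv
  set r := Real.sqrt (x ^ 2 + y ^ 2)
  have hx : |x| ≤ r := Real.abs_le_sqrt (by nlinarith [sq_nonneg y])
  have hy : |y| ≤ r := Real.abs_le_sqrt (by nlinarith [sq_nonneg x])
  have hsqrt : ∀ p q : ℝ, Real.sqrt (p ^ 2 + q ^ 2) ≤ |p| + |q| := fun p q => by
    apply Real.sqrt_le_iff.mpr
    refine ⟨by positivity, ?_⟩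
    rw [← sq_abs p, ← sq_abs q]
    nlinarith [mul_nonneg (abs_nonneg p) (abs_nonneg q)]
  refine (hsqrt _ _).trans ?_
  have h1 : |-(T ^ 2 * f)| ≤ T ^ 2 * (K * r) := by
    rw [abs_neg, abs_mul, abs_of_pos (by positivity : 0 < T ^ 2)]; gcongr
  have h2 : |a * t * y| ≤ a * |t| * r := by
    rw [abs_mul, abs_mul, abs_of_pos ha]; gcongr
  have h3 : |v * (Real.cos t - 1)| ≤ w * |t| := by
    rw [abs_mul]; exact mul_le_mul hv (abs_cos_sub_one_le t) (abs_nonneg _) hw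
  have h4 : |-(a * t * x)| ≤ a * |t| * r := by
    rw [abs_neg, abs_mul, abs_mul, abs_of_pos ha]; gcongr
  have h5 : |v * Real.sin t| ≤ w * |t| := by
    rw [abs_mul]; exact mul_le_mul hv Real.abs_sin_le_abs (abs_nonneg _) hw
  have h6 : |-(T ^ 2 * f) + T * (a * t * y + v * (Real.cos t - 1))| ≤
      T ^ 2 * (K * r) + T * (a * |t| * r + w * |t|) := by
    refine (abs_add_le _ _).trans (add_le_add h1 ?_)
    rw [abs_mul, abs_of_pos hT]
    gcongr
    exact (abs_add_le _ _).trans (add_le_add h2 h3)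
  have h7 : |T * (-(a * t * x) + v * Real.sin t)| ≤ T * (a * |t| * r + w * |t|) := by
    rw [abs_mul, abs_of_pos hT]
    gcongr
    exact (abs_add_le _ _).trans (add_le_add h4 h5)
  linarith

/-- A comparison lemma for a decaying scalar sequence driven by a geometrically decaying one. -/
theorem cascade_decay {W t : ℕ → ℝ} {T a c A B κ b : ℝ} (hT : 0 < T) (ha : 0 < a)
    (hTa : T * a ≤ 1) (hA : 0 ≤ A) (hW0 : ∀ n, 0 ≤ W n)
    (hW : ∀ n, W (n + 1) ≤ (1 - c * T + A * a * T * |t n|) * W n + B * T * |t n|)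
    (ht : ∀ n, t (n + 1) = (1 - T * a) * t n) (hκ : κ ≤ c) (hκa : κ ≤ a / 2)
    (hb0 : 0 ≤ b) (hb : 2 * B ≤ b * a) (n : ℕ) :
    W n + b * |t n| ≤ (W 0 + b * |t 0|) * Real.exp (A * |t 0|) * Real.exp (-(κ * (n * T))) := by
  have ht' : ∀ n, |t (n + 1)| = (1 - T * a) * |t n| := fun n => by
    rw [ht, abs_mul, abs_of_nonneg (by linarith)]
  have key : ∀ n : ℕ, (W n + b * |t n|) * Real.exp (A * |t n|) ≤
      (W 0 + b * |t 0|) * Real.exp (A * |t 0|) * Real.exp (-(κ * (n * T))) := by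
    intro n
    induction n with
    | zero => simp
    | succ n ih =>
      have hU0 : 0 ≤ W n + b * |t n| := add_nonneg (hW0 n) (by positivity)
      have hstep : W (n + 1) + b * |t (n + 1)| ≤
          (-(κ * T) + A * a * T * |t n| + 1) * (W n + b * |t n|) := by
        have h1 := hW n
        have h2 := mul_le_mul_of_nonneg_right hb (mul_nonneg hT.le (abs_nonneg (t n)))
        have h3 := mul_le_mul_of_nonneg_right hκ (mul_nonneg hT.le (hW0 n))
        have h4 := mul_le_mul_of_nonneg_right hκa
          (mul_nonneg hT.le (mul_nonneg hb0 (abs_nonneg (t n))))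
        have h5 : 0 ≤ A * a * T * |t n| * (b * |t n|) := by positivity
        rw [ht']
        linarith
      calc (W (n + 1) + b * |t (n + 1)|) * Real.exp (A * |t (n + 1)|)
          ≤ (Real.exp (-(κ * T) + A * a * T * |t n|) * (W n + b * |t n|)) *
              Real.exp (A * |t (n + 1)|) := by
            gcongr
            refine hstep.trans ?_
            gcongr
            exact Real.add_one_le_exp _
        _ = (W n + b * |t n|) * Real.exp (A * |t n|) * Real.exp (-(κ * T)) := by
            have h : Real.exp (-(κ * T) + A * a * T * |t n|) * Real.exp (A * |t (n + 1)|) =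
                Real.exp (A * |t n|) * Real.exp (-(κ * T)) := by
              rw [ht', ← Real.exp_add, ← Real.exp_add]
              ring_nf
            rw [mul_right_comm, h]
            ring
        _ ≤ (W 0 + b * |t 0|) * Real.exp (A * |t 0|) * Real.exp (-(κ * (n * T))) *
              Real.exp (-(κ * T)) := by gcongr
        _ = _ := by
            rw [mul_assoc _ (Real.exp (-(κ * (n * T)))), ← Real.exp_add]
            push_cast
            ring_nf
  refine le_trans ?_ (key n)
  have hU0 : 0 ≤ W n + b * |t n| := add_nonneg (hW0 n) (by positivity)
  exact le_mul_of_one_le_right hU0 (Real.one_le_exp (by positivity))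

theorem classKL_mul_exp {D A κ : ℝ} (hD : 0 < D) (hA : 0 ≤ A) (hκ : 0 < κ) :
    ClassKL fun s t => D * s * Real.exp (A * s) * Real.exp (-(κ * t)) := by
  refine ⟨fun t _ => ⟨by fun_prop, ?_, by simp⟩, fun s hs => ⟨?_, ?_⟩⟩
  · intro x hx y _ hxy
    have hx : 0 ≤ x := hx
    have h1 : Real.exp (A * x) ≤ Real.exp (A * y) := Real.exp_le_exp.mpr (by gcongr)
    have h2 : D * x * Real.exp (A * x) < D * y * Real.exp (A * y) :=
      mul_lt_mul (by gcongr) h1 (Real.exp_pos _) (by have : 0 < y := hx.trans_lt hxy; positivity)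
    exact mul_lt_mul_of_pos_right h2 (Real.exp_pos _)
  · intro x _ y _ hxy
    dsimp only
    gcongr
  · have h1 : Tendsto (fun t : ℝ => κ * t) atTop atTop := tendsto_id.const_mul_atTop hκ
    have h2 := (Real.tendsto_exp_neg_atTop_nhds_zero.comp h1).const_mul
      (D * s * Real.exp (A * s))
    simpa using h2

/-- One closed-loop step, measured by the square root of the Lyapunov function. -/
theorem sqrt_trackV_step_le {γ ω ω' S S' T w s K a v f t x y Γ c : ℝ} (hT : 0 < T) (hT1 : T ≤ 1)
    (hs : 0 < s) (hω : |ω| ≤ w) (hω' : |ω'| ≤ w) (hd : |ω' - ω| ≤ T * w)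
    (hsS : s ≤ S) (hSw : S ≤ 2 * w ^ 2)
    (hsS' : s ≤ S') (hS' : S' ≤ 2 * w ^ 2) (hS : S = T * ω ^ 2 + S' / (1 + T))
    (hγ : 1 + w + 2 * w ^ 2 ≤ γ) (hγ' : w ^ 2 + (2 * w + 4 * w ^ 3) ^ 2 / s + s ≤ 2 * γ)
    (hTR : T * (γ * (1 + w + w ^ 2) + w ^ 2 + w ^ 3) ≤ s / 8)
    (hΓ : Γ = γ + w + 2 * w ^ 2) (hc : 16 * Γ * c = s) (hTc : c * T ≤ 1)
    (hTK : Γ * (T * K) ≤ c / 2) (ha : 0 < a) (hv : |v| ≤ w)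
    (hf : |f| ≤ K * Real.sqrt (x ^ 2 + y ^ 2)) (hK : 0 < K) :
    Real.sqrt (trackV γ ω' S'
        ((1 - T) * x + T * ω * y - T ^ 2 * f + T * (a * t * y - v + v * Real.cos t))
        (y - T * ω * x + T * (-(a * t * x) + v * Real.sin t))) ≤
      (1 - c / 2 * T + 2 * Γ * a * T * |t|) * Real.sqrt (trackV γ ω S x y)
        + 2 * Γ * w * T * |t| := by
  have hw : 0 ≤ w := (abs_nonneg _).trans hω
  have hγ0 : 0 ≤ γ := le_trans (by positivity) hγ
  have hΓ0 : 0 ≤ Γ := by rw [hΓ]; positivity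
  have hS0 : 0 ≤ S := hs.le.trans hsS
  have hVr := le_trackV (x := x) (y := y) hω hSw hγ
  have hV0 : 0 ≤ trackV γ ω S x y := (by positivity : 0 ≤ x ^ 2 + y ^ 2).trans hVr
  set W := Real.sqrt (trackV γ ω S x y) with hW
  have hrW : Real.sqrt (x ^ 2 + y ^ 2) ≤ W := Real.sqrt_le_sqrt hVr
  have hlin : Real.sqrt (trackV γ ω' S' ((1 - T) * x + T * ω * y) (y - T * ω * x)) ≤
      (1 - c * T) * W := by
    have h1 := trackV_step_le (x := x) (y := y) hT hT1 hs hω hω' hd hsS' hS' hS hγ0 hγ' hTR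
    have h2 : trackV γ ω S x y ≤ Γ * (x ^ 2 + y ^ 2) := by
      refine (trackV_le hω hS0).trans ?_
      rw [hΓ]
      exact mul_le_mul_of_nonneg_right (by linarith [sq_nonneg w]) (by positivity)
    have hc0 : 0 ≤ c := by
      by_contra h
      nlinarith
    have h3 := mul_le_mul_of_nonneg_left h2 (mul_nonneg hT.le hc0)
    have h4 : T * (s / 8) * (x ^ 2 + y ^ 2) = 2 * (T * c * (Γ * (x ^ 2 + y ^ 2))) := by
      rw [← hc]; ring
    have hW2 : W ^ 2 = trackV γ ω S x y := Real.sq_sqrt hV0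
    apply Real.sqrt_le_iff.mpr
    refine ⟨mul_nonneg (by linarith) (Real.sqrt_nonneg _), ?_⟩
    rw [mul_pow, hW2]
    nlinarith [mul_nonneg (sq_nonneg (c * T)) hV0]
  have hpert := sqrt_tracking_perturbation_le (t := t) hT ha hv hf
  have hadd := sqrt_trackV_add_le (x := (1 - T) * x + T * ω * y) (y := y - T * ω * x)
    (p := -(T ^ 2 * f) + T * (a * t * y + v * (Real.cos t - 1)))
    (q := T * (-(a * t * x) + v * Real.sin t)) hω' (hs.le.trans hsS') hS' hγ
  rw [← hΓ] at hadd
  rw [show (1 - T) * x + T * ω * y - T ^ 2 * f + T * (a * t * y - v + v * Real.cos t) =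
    (1 - T) * x + T * ω * y + (-(T ^ 2 * f) + T * (a * t * y + v * (Real.cos t - 1))) by ring]
  have h5 := mul_le_mul_of_nonneg_left hpert hΓ0
  have h6 : Γ * ((T ^ 2 * K + 2 * (T * a * |t|)) * Real.sqrt (x ^ 2 + y ^ 2)) ≤
      Γ * ((T ^ 2 * K + 2 * (T * a * |t|)) * W) := by gcongr
  have h7 := mul_le_mul_of_nonneg_right hTK (mul_nonneg hT.le (Real.sqrt_nonneg _ : 0 ≤ W))
  linarith

/-- Proposition 3: for the Euler closed-loop unicycle tracking error dynamics,
under boundedness of the reference velocities (and of the difference quotient of `ω_r`) and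
persistency of excitation of `ω_r`, there exists `a₂ > 0` such that for all gains `K, a₁ > 0`
and all correction terms `ϑ` with `|ϑ(k,x)| ≤ K|x|`, the closed-loop family is UGAS. -/
theorem stmt14 (vr wr : ℝ → ℤ → ℝ)
    (hbound : ∃ That wM : ℝ, 0 < That ∧ 0 < wM ∧ ∀ T : ℝ, 0 < T → T < That →
      (∀ k : ℤ, -1 ≤ k → |wr T k| ≤ wM) ∧
      (∀ k : ℤ, 0 ≤ k → |vr T k| ≤ wM ∧ |wr T k - wr T (k - 1)| / T ≤ wM))
    (hPE : ∃ μ L Tpe : ℝ, 0 < μ ∧ 0 < L ∧ 0 < Tpe ∧ ∀ T : ℝ, 0 < T → T < Tpe →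
      ∀ j : ℕ, μ ≤ T * ∑ k ∈ Finset.Icc j (j + Nat.floor (L / T)), (wr T (k : ℤ)) ^ 2) :
    ∃ a₂ : ℝ, 0 < a₂ ∧ ∀ K a₁ : ℝ, 0 < K → 0 < a₁ →
      ∀ ϑ : ℕ → ℝ → ℝ → ℝ,
        (∀ k xe ye, |ϑ k xe ye| ≤ K * Real.sqrt (xe ^ 2 + ye ^ 2)) →
        ∃ β : ℝ → ℝ → ℝ, ClassKL β ∧ ∃ Tstar : ℝ, 0 < Tstar ∧
          ∀ T : ℝ, 0 < T → T < Tstar → ∀ k₀ : ℕ, ∀ xe ye te : ℕ → ℝ,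
            (∀ k, k₀ ≤ k →
              xe (k + 1) = (1 - T * a₂) * xe k + T * wr T (k : ℤ) * ye k
                - T ^ 2 * ϑ k (xe k) (ye k)
                + T * (a₁ * te k * ye k - vr T (k : ℤ) + vr T (k : ℤ) * Real.cos (te k)) ∧
              ye (k + 1) = ye k - T * wr T (k : ℤ) * xe k
                + T * (-(a₁ * te k * xe k) + vr T (k : ℤ) * Real.sin (te k)) ∧
              te (k + 1) = (1 - T * a₁) * te k) →
            ∀ k, k₀ ≤ k →
              Real.sqrt ((xe k) ^ 2 + (ye k) ^ 2 + (te k) ^ 2) ≤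
                β (Real.sqrt ((xe k₀) ^ 2 + (ye k₀) ^ 2 + (te k₀) ^ 2))
                  (((k - k₀ : ℕ) : ℝ) * T) := by
  obtain ⟨That, w, hThat, hw, hb⟩ := hbound
  obtain ⟨μ, L, Tpe, hμ, hL, hTpe, hpe⟩ := hPE
  set s : ℝ := Real.exp (-L) * μ with hs_def
  have hs : 0 < s := by positivity
  set γ : ℝ := 1 + w + 2 * w ^ 2 + (w ^ 2 + (2 * w + 4 * w ^ 3) ^ 2 / s + s) with hγ_def
  have hq0 : 0 < w ^ 2 + (2 * w + 4 * w ^ 3) ^ 2 / s + s := by positivity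
  have hγ : 1 + w + 2 * w ^ 2 ≤ γ := by linarith
  have hγ' : w ^ 2 + (2 * w + 4 * w ^ 3) ^ 2 / s + s ≤ 2 * γ := by
    have : 0 < 1 + w + 2 * w ^ 2 := by positivity
    linarith
  have hγ1 : 1 ≤ γ := le_trans (by linarith [sq_nonneg w]) hγ
  set R : ℝ := γ * (1 + w + w ^ 2) + w ^ 2 + w ^ 3 with hR
  have hR0 : 0 < R := by positivity
  obtain ⟨Γ, hΓ⟩ : ∃ Γ : ℝ, Γ = γ + w + 2 * w ^ 2 := ⟨_, rfl⟩
  have hΓ1 : 1 ≤ Γ := by linarith [sq_nonneg w]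
  have hΓ0 : 0 < Γ := by linarith
  obtain ⟨c, hc_def⟩ : ∃ c : ℝ, c = s / (16 * Γ) := ⟨_, rfl⟩
  have hc0 : 0 < c := by rw [hc_def]; positivity
  have hc : 16 * Γ * c = s := by rw [hc_def]; field_simp
  refine ⟨1, one_pos, fun K a hK ha ϑ hϑ => ?_⟩
  set b : ℝ := 4 * Γ * w / a + 1 with hb_def
  have hb1 : 1 ≤ b := by
    have : 0 < 4 * Γ * w / a := by positivity
    linarith
  have hba : 2 * (2 * Γ * w) ≤ b * a := by
    have : b * a = 4 * Γ * w + a := by rw [hb_def]; field_simp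
    linarith
  set κ : ℝ := min (c / 2) (a / 2) with hκ_def
  have hκ : 0 < κ := by positivity
  refine ⟨_, classKL_mul_exp (D := Γ + b) (A := 2 * Γ) (κ := κ) (by linarith) (by linarith) hκ,
    min That (min Tpe (min 1 (min (s / 8 / R) (min (1 / c) (min (c / 2 / (Γ * K)) (1 / a)))))),
    by positivity, fun T hT hTlt k₀ xe ye te hsys k hk => ?_⟩
  simp only [lt_min_iff] at hTlt
  obtain ⟨hT1, hT2, hT3, hT4, hT5, hT6, hT7⟩ := hTlt
  rw [lt_div_iff₀ (by positivity)] at hT4 hT5 hT6 hT7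
  obtain ⟨hωb, hvb⟩ := hb T hT hT1
  obtain ⟨S, hS⟩ := exists_discounted_excitation (ω := fun k : ℕ => wr T (k : ℤ)) (L := L) (w := w)
    hT hT3.le (fun k => hωb k (by omega))
    ((le_div_iff₀ hT).mp (Nat.floor_le (by positivity : 0 ≤ L / T))) (hpe T hT hT2)
  simp only [← hs_def] at hS
  set W : ℕ → ℝ := fun n =>
    Real.sqrt (trackV γ (wr T ((k₀ + n : ℕ) : ℤ)) (S (k₀ + n)) (xe (k₀ + n)) (ye (k₀ + n))) with hW
  have hstep : ∀ n, W (n + 1) ≤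
      (1 - c / 2 * T + 2 * Γ * a * T * |te (k₀ + n)|) * W n + 2 * Γ * w * T * |te (k₀ + n)| := by
    intro n
    obtain ⟨h1, h2, -⟩ := hsys (k₀ + n) (by omega)
    rw [mul_one] at h1
    have hd := (hvb ((k₀ + n + 1 : ℕ) : ℤ) (by omega)).2
    rw [div_le_iff₀ hT, show ((k₀ + n + 1 : ℕ) : ℤ) - 1 = ((k₀ + n : ℕ) : ℤ) by push_cast; ring,
      mul_comm] at hd
    simp only [hW, ← add_assoc, h1, h2]
    exact sqrt_trackV_step_le hT hT3.le hs (hωb _ (by omega)) (hωb _ (by omega)) hd (hS _).1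
      (hS _).2.1 (hS _).1 (hS _).2.1 (hS _).2.2 hγ hγ' hT4.le hΓ hc (by linarith) (by linarith) ha
      (hvb _ (by omega)).1 (hϑ _ _ _) hK
  obtain ⟨n, rfl⟩ := Nat.exists_eq_add_of_le hk
  have hdecay := cascade_decay (W := W) (A := 2 * Γ) (t := fun n => te (k₀ + n)) hT ha hT7.le (by positivity)
    (fun n => Real.sqrt_nonneg _) hstep (fun n => (hsys (k₀ + n) (by omega)).2.2)
    (min_le_left _ _ : κ ≤ _) (min_le_right _ _) (by linarith) hba n
  have hlow : Real.sqrt (xe (k₀ + n) ^ 2 + ye (k₀ + n) ^ 2 + te (k₀ + n) ^ 2) ≤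
      W n + b * |te (k₀ + n)| := by
    have h1 : Real.sqrt (xe (k₀ + n) ^ 2 + ye (k₀ + n) ^ 2) ≤ W n :=
      Real.sqrt_le_sqrt (le_trackV (hωb _ (by omega)) (hS _).2.1 hγ)
    have h2 : |te (k₀ + n)| ≤ b * |te (k₀ + n)| := le_mul_of_one_le_left (abs_nonneg _) hb1
    have h3 : Real.sqrt (xe (k₀ + n) ^ 2 + ye (k₀ + n) ^ 2 + te (k₀ + n) ^ 2) ≤
        Real.sqrt (xe (k₀ + n) ^ 2 + ye (k₀ + n) ^ 2) + |te (k₀ + n)| := by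
      apply Real.sqrt_le_iff.mpr
      refine ⟨by positivity, ?_⟩
      rw [add_sq, Real.sq_sqrt (by positivity), sq_abs]
      have : 0 ≤ 2 * Real.sqrt (xe (k₀ + n) ^ 2 + ye (k₀ + n) ^ 2) * |te (k₀ + n)| := by
        positivity
      linarith
    linarith
  set σ : ℝ := Real.sqrt (xe k₀ ^ 2 + ye k₀ ^ 2 + te k₀ ^ 2) with hσ
  have hσ0 : 0 ≤ σ := Real.sqrt_nonneg _
  have htσ : |te k₀| ≤ σ := Real.abs_le_sqrt (by linarith [sq_nonneg (xe k₀), sq_nonneg (ye k₀)])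
  have hWσ : W 0 ≤ Γ * σ := by
    have h1 := trackV_le (γ := γ) (x := xe k₀) (y := ye k₀) (hωb k₀ (by omega))
      (hs.le.trans (hS k₀).1)
    have h2 : σ ^ 2 = xe k₀ ^ 2 + ye k₀ ^ 2 + te k₀ ^ 2 := Real.sq_sqrt (by positivity)
    apply Real.sqrt_le_iff.mpr
    refine ⟨by positivity, h1.trans ?_⟩
    rw [mul_pow]
    apply mul_le_mul _ _ (by positivity) (by positivity)
    · calc γ + w ≤ Γ := by linarith [sq_nonneg w]
        _ ≤ Γ ^ 2 := le_self_pow₀ hΓ1 two_ne_zero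
    · linarith [sq_nonneg (te k₀)]
  simp only [add_zero] at hdecay
  rw [Nat.add_sub_cancel_left]
  refine hlow.trans (hdecay.trans ?_)
  have h1 : W 0 + b * |te k₀| ≤ (Γ + b) * σ := by
    have := mul_le_mul_of_nonneg_left htσ (by linarith : 0 ≤ b)
    linarith
  gcongr
end
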